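/- arXiv:1512.04047 — 9 statements merged into one kernel-verified Lean document; each statement's English description precedes it below -/
import Mathlib

section
/- Let G = (V,E) be a graph, let H = (W,F) be an induced subgraph of G, and let T ⊆ F be a set of exactly τ(H) edges of H such that every triangle of G containing an edge of H contains an edge of T. Then for every k ≥ τ(H): G has a triangle-free deletion set of size at most k if and only if G ∖ T has a triangle-free deletion set of size at most k − τ(H). -/
open SimpleGraph

/-- `τ` of the subgraph of `G` induced by `W`: the minimum size of a set `T` of edges of
`G` lying inside `W` whose deletion makes the induced subgraph on `W` triangle-free. -/
noncomputable def tauTriOn {V : Type*} [Fintype V] [DecidableEq V]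
    (G : SimpleGraph V) (W : Finset V) : ℕ :=
  sInf {n | ∃ T : Finset (Sym2 V), ↑T ⊆ G.edgeSet ∧ (∀ e ∈ T, ∀ v ∈ e, v ∈ W) ∧
    T.card = n ∧ ((G.deleteEdges ↑T).induce (W : Set V)).CliqueFree 3}

theorem SimpleGraph.cliqueFree_three_iff {V : Type*} (G : SimpleGraph V) :
    G.CliqueFree 3 ↔ ∀ a b c : V, G.Adj a b → G.Adj a c → ¬ G.Adj b c := by
  classical
  refine ⟨fun h a b c hab hac hbc =>
    h {a, b, c} (is3Clique_triple_iff.2 ⟨hab, hac, hbc⟩), fun h s hs => ?_⟩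
  obtain ⟨a, b, c, hab, hac, hbc, -⟩ := is3Clique_iff.1 hs
  exact h a b c hab hac hbc

/-- The edges inside `W` of a triangle-free deletion set of `G` form a triangle-free deletion
set of the subgraph induced by `W`, so there are at least `tauTriOn G W` of them. -/
theorem tauTriOn_le_card_filter {V : Type*} [Fintype V] [DecidableEq V]
    (G : SimpleGraph V) (W : Finset V) (S : Finset (Sym2 V))
    (hS : ↑S ⊆ G.edgeSet) (hfree : (G.deleteEdges ↑S).CliqueFree 3) :
    tauTriOn G W ≤ (S.filter fun e => ∀ v ∈ e, v ∈ W).card := by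
  refine Nat.sInf_le ⟨_, fun e he => hS (Finset.mem_filter.1 he).1,
    fun e he => (Finset.mem_filter.1 he).2, rfl, ?_⟩
  rw [cliqueFree_three_iff] at hfree ⊢
  rintro ⟨a, ha⟩ ⟨b, hb⟩ ⟨c, hc⟩ hab hac hbc
  rw [Finset.mem_coe] at ha hb hc
  refine hfree a b c ?_ ?_ ?_ <;> simp_all [deleteEdges_adj]

/-- correctness of Rule 1 for Triangle Deletion. Let `H` be the subgraph
of `G` induced by `W` and let `T` be a set of exactly `τ(H)` edges of `H` such that every
triangle of `G` containing an edge of `H` contains an edge of `T`. Then for every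
`k ≥ τ(H)`, `G` has a triangle-free deletion set of size at most `k` iff `G ∖ T` has one
of size at most `k - τ(H)`. -/
theorem stmt1 {V : Type*} [Fintype V] [DecidableEq V]
    (G : SimpleGraph V) (W : Finset V) (T : Finset (Sym2 V))
    (hTsub : ↑T ⊆ G.edgeSet) (hTW : ∀ e ∈ T, ∀ v ∈ e, v ∈ W)
    (hTcard : T.card = tauTriOn G W)
    (hdestroy : ∀ a b c : V, G.Adj a b → G.Adj a c → G.Adj b c →
      ((a ∈ W ∧ b ∈ W) ∨ (a ∈ W ∧ c ∈ W) ∨ (b ∈ W ∧ c ∈ W)) →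
      (s(a, b) ∈ T ∨ s(a, c) ∈ T ∨ s(b, c) ∈ T))
    (k : ℕ) (hk : tauTriOn G W ≤ k) :
    (∃ S : Finset (Sym2 V), ↑S ⊆ G.edgeSet ∧ S.card ≤ k ∧
        (G.deleteEdges ↑S).CliqueFree 3) ↔
    (∃ S : Finset (Sym2 V), ↑S ⊆ (G.deleteEdges ↑T).edgeSet ∧
        S.card ≤ k - tauTriOn G W ∧
        ((G.deleteEdges ↑T).deleteEdges ↑S).CliqueFree 3) := by
  constructor
  · rintro ⟨S, hS, hSk, hfree⟩
    have hle := tauTriOn_le_card_filter G W S hS hfree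
    have hsum := S.card_filter_add_card_filter_not (fun e => ∀ v ∈ e, v ∈ W)
    refine ⟨S.filter fun e => ¬ ∀ v ∈ e, v ∈ W, fun e he => ?_, by omega, ?_⟩
    · obtain ⟨heS, heW⟩ := Finset.mem_filter.1 he
      rw [edgeSet_deleteEdges]
      exact ⟨hS heS, fun heT => heW (hTW e heT)⟩
    · rw [cliqueFree_three_iff] at hfree ⊢
      intro a b c hab hac hbc
      have hd := hdestroy a b c
      have hf := hfree a b c
      simp only [deleteEdges_adj, Finset.mem_coe, Finset.mem_filter, Sym2.mem_iff,
        forall_eq_or_imp, forall_eq] at hab hac hbc hf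
      tauto
  · rintro ⟨S, hS, hSk, hfree⟩
    refine ⟨T ∪ S, ?_, ?_, ?_⟩
    · rw [Finset.coe_union]
      exact Set.union_subset hTsub (hS.trans (edgeSet_mono (deleteEdges_le _)))
    · have := Finset.card_union_le T S
      omega
    · rwa [Finset.coe_union, ← deleteEdges_deleteEdges]
end

section
/- Let G = (V,E) be a graph and H = (W,F) an induced subgraph of G. Suppose there is NO set T ⊆ F of exactly τ(H) edges such that every triangle of G containing an edge of H contains an edge of T. Then there exists a certificate for H: a set 𝒯 of triangles of G, each containing exactly one edge of H, with pairwise distinct edges of H across the triangles of 𝒯, such that either |𝒯| = τ(H)+1, or |𝒯| ≤ τ(H) and τ(H′) > τ(H) − |𝒯|, where H′ is the graph obtained from H by deleting, for each triangle in 𝒯, its edge shared with H. -/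
open SimpleGraph

theorem induce_cliqueFree_three_iff {V : Type*} (K : SimpleGraph V) (W : Set V) :
    (K.induce W).CliqueFree 3 ↔
      ∀ a ∈ W, ∀ b ∈ W, ∀ c ∈ W, K.Adj a b → K.Adj a c → ¬ K.Adj b c := by
  classical
  constructor
  · intro h a ha b hb c hc hab hac hbc
    exact h {⟨a, ha⟩, ⟨b, hb⟩, ⟨c, hc⟩}
      (is3Clique_triple_iff.2 ⟨induce_adj.2 hab, induce_adj.2 hac, induce_adj.2 hbc⟩)
  · intro h t ht
    obtain ⟨a, b, c, hab, hac, hbc, -⟩ := is3Clique_iff.1 ht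
    exact h a a.2 b b.2 c c.2 hab hac hbc

theorem exists_card_eq_tauTriOn {V : Type*} [Fintype V] [DecidableEq V]
    (G : SimpleGraph V) (W : Finset V) :
    ∃ T : Finset (Sym2 V), ↑T ⊆ G.edgeSet ∧ (∀ e ∈ T, ∀ v ∈ e, v ∈ W) ∧
      T.card = tauTriOn G W ∧ ((G.deleteEdges ↑T).induce (W : Set V)).CliqueFree 3 := by
  classical
  refine Nat.sInf_mem (s := {n | ∃ T : Finset (Sym2 V), ↑T ⊆ G.edgeSet ∧
    (∀ e ∈ T, ∀ v ∈ e, v ∈ W) ∧ T.card = n ∧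
    ((G.deleteEdges ↑T).induce (W : Set V)).CliqueFree 3}) ?_
  refine ⟨_, Finset.univ.filter (fun e => e ∈ G.edgeSet ∧ ∀ v ∈ e, v ∈ W), ?_, ?_, rfl, ?_⟩
  · intro e he
    exact (Finset.mem_filter.1 he).2.1
  · intro e he
    exact (Finset.mem_filter.1 he).2.2
  · rw [induce_cliqueFree_three_iff]
    intro a ha b hb c hc hab
    simp_all [deleteEdges_adj]

theorem tauTriOn_le_card {V : Type*} [Fintype V] [DecidableEq V]
    {G : SimpleGraph V} {W : Finset V} {T : Finset (Sym2 V)} (hG : ↑T ⊆ G.edgeSet)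
    (hW : ∀ e ∈ T, ∀ v ∈ e, v ∈ W)
    (hfree : ((G.deleteEdges ↑T).induce (W : Set V)).CliqueFree 3) :
    tauTriOn G W ≤ T.card :=
  Nat.sInf_le ⟨T, hG, hW, rfl, hfree⟩

/-- The triangle `t` of `G` meets the subgraph induced by `W` in the single edge `e`. -/
def IsTriangleThrough {V : Type*} (G : SimpleGraph V) (W : Finset V)
    (e : Sym2 V) (t : Finset V) : Prop :=
  G.IsNClique 3 t ∧ (¬ e.IsDiag ∧ (∀ v ∈ e, v ∈ t) ∧ (∀ v ∈ e, v ∈ W)) ∧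
    ∀ e' : Sym2 V, ¬ e'.IsDiag → (∀ v ∈ e', v ∈ t) → (∀ v ∈ e', v ∈ W) → e' = e

theorem IsTriangleThrough.mem_edgeSet {V : Type*} {G : SimpleGraph V}
    {W : Finset V} {e : Sym2 V} {t : Finset V} (h : IsTriangleThrough G W e t) :
    e ∈ G.edgeSet := by
  obtain ⟨ht, ⟨hd, he, -⟩, -⟩ := h
  induction e with
  | _ a b =>
    exact ht.isClique (he a (by simp)) (he b (by simp)) (by simpa using hd)

theorem isTriangleThrough_of_adj {V : Type*} [DecidableEq V] {G : SimpleGraph V}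
    {W : Finset V} {a b c : V} (hab : G.Adj a b) (hac : G.Adj a c) (hbc : G.Adj b c)
    (ha : a ∈ W) (hb : b ∈ W) (hc : c ∉ W) :
    IsTriangleThrough G W s(a, b) {a, b, c} := by
  refine ⟨is3Clique_triple_iff.2 ⟨hab, hac, hbc⟩, ⟨by simpa using hab.ne, ?_, ?_⟩, ?_⟩
  · simp
  · simp [ha, hb]
  · intro e
    induction e with
    | _ x y =>
      intro hxy ht hW
      simp only [Sym2.mem_iff, forall_eq_or_imp, forall_eq, Finset.mem_insert,
        Finset.mem_singleton] at ht hW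
      simp only [Sym2.mk_isDiag_iff] at hxy
      rw [Sym2.eq_iff]
      grind

theorem exists_triangles_of_forall {V : Type*} [Nonempty V]
    {G : SimpleGraph V} {W : Finset V} (A : Finset (Sym2 V))
    (hA : ∀ e ∈ A, ∃ t, IsTriangleThrough G W e t) :
    ∃ (𝒯 : Finset (Finset V)) (f : Finset V → Sym2 V),
      (∀ t ∈ 𝒯, IsTriangleThrough G W (f t) t) ∧ Set.InjOn f ↑𝒯 ∧
      𝒯.card = A.card ∧ f '' ↑𝒯 = ↑A := by
  classical
  have : Nonempty (Sym2 V) := ⟨s(Classical.arbitrary V, Classical.arbitrary V)⟩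
  choose! g hg using hA
  have hinj : Set.InjOn g ↑A := fun e he e' he' h => by
    have h' := (hg e' he').2.1
    rw [← h] at h'
    exact ((hg e he).2.2 e' h'.1 h'.2.1 h'.2.2).symm
  have hleft := hinj.leftInvOn_invFunOn
  refine ⟨A.image g, Function.invFunOn g ↑A, ?_, ?_, Finset.card_image_of_injOn hinj, ?_⟩
  · intro t ht
    obtain ⟨e, he, rfl⟩ := Finset.mem_image.1 ht
    rw [hleft he]
    exact hg e he
  · rw [Finset.coe_image]
    exact Function.invFunOn_injOn_image g ↑A
  · rw [Finset.coe_image]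
    exact hleft.image_image

/-- existence of certificates. Let `H` be the subgraph of `G` induced by
`W` and suppose there is no set `T` of exactly `τ(H)` edges of `H` such that every
triangle of `G` containing an edge of `H` contains an edge of `T`. Then there is a
certificate: a set `𝒯` of triangles of `G`, each containing exactly one edge of `H`
(given by `f`), with pairwise distinct `H`-edges across the triangles, such that
`|𝒯| = τ(H) + 1`, or `|𝒯| ≤ τ(H)` and `τ(H') > τ(H) - |𝒯|` where `H'` is obtained
from `H` by deleting the shared edges. -/
theorem stmt2 {V : Type*} [Fintype V] [DecidableEq V]
    (G : SimpleGraph V) (W : Finset V)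
    (hno : ¬ ∃ T : Finset (Sym2 V), ↑T ⊆ G.edgeSet ∧ (∀ e ∈ T, ∀ v ∈ e, v ∈ W) ∧
      T.card = tauTriOn G W ∧
      (∀ a b c : V, G.Adj a b → G.Adj a c → G.Adj b c →
        ((a ∈ W ∧ b ∈ W) ∨ (a ∈ W ∧ c ∈ W) ∨ (b ∈ W ∧ c ∈ W)) →
        (s(a, b) ∈ T ∨ s(a, c) ∈ T ∨ s(b, c) ∈ T))) :
    ∃ (𝒯 : Finset (Finset V)) (f : Finset V → Sym2 V),
      (∀ t ∈ 𝒯, G.IsNClique 3 t) ∧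
      (∀ t ∈ 𝒯,
        (¬ (f t).IsDiag ∧ (∀ v ∈ f t, v ∈ t) ∧ (∀ v ∈ f t, v ∈ W)) ∧
        (∀ e : Sym2 V, ¬ e.IsDiag → (∀ v ∈ e, v ∈ t) → (∀ v ∈ e, v ∈ W) → e = f t)) ∧
      Set.InjOn f ↑𝒯 ∧
      (𝒯.card = tauTriOn G W + 1 ∨
        (𝒯.card ≤ tauTriOn G W ∧
          tauTriOn G W - 𝒯.card < tauTriOn (G.deleteEdges (f '' ↑𝒯)) W)) := by
  classical
  have hne : Nonempty V := by
    by_contra hV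
    rw [not_nonempty_iff] at hV
    obtain ⟨T, hG, hW, hcard, -⟩ := exists_card_eq_tauTriOn G W
    exact hno ⟨T, hG, hW, hcard, fun a => hV.elim a⟩
  set A : Finset (Sym2 V) :=
    Finset.univ.filter (fun e => ∃ t, IsTriangleThrough G W e t)
  have hA : ∀ e ∈ A, ∃ t, IsTriangleThrough G W e t := fun e he =>
    (Finset.mem_filter.1 he).2
  rcases Nat.lt_or_ge (tauTriOn G W) A.card with hlt | hle
  · obtain ⟨B, hBA, hB⟩ := Finset.exists_subset_card_eq (Nat.succ_le_of_lt hlt)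
    obtain ⟨𝒯, f, hf, hinj, hcard, -⟩ :=
      exists_triangles_of_forall B fun e he => hA e (hBA he)
    exact ⟨𝒯, f, fun t ht => (hf t ht).1, fun t ht => (hf t ht).2, hinj,
      Or.inl (hcard.trans hB)⟩
  · obtain ⟨𝒯, f, hf, hinj, hcard, himage⟩ := exists_triangles_of_forall A hA
    refine ⟨𝒯, f, fun t ht => (hf t ht).1, fun t ht => (hf t ht).2, hinj,
      Or.inr ⟨hcard.trans_le hle, ?_⟩⟩
    rw [himage, hcard]
    by_contra! hsmall
    obtain ⟨T, hTG, hTW, hTcard, hTfree⟩ := exists_card_eq_tauTriOn (G.deleteEdges ↑A) W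
    rw [deleteEdges_deleteEdges, ← Finset.coe_union] at hTfree
    have hG : ↑(A ∪ T) ⊆ G.edgeSet := by
      intro e he
      rcases Finset.mem_union.1 he with h | h
      · exact (hA e h).choose_spec.mem_edgeSet
      · exact edgeSet_mono (deleteEdges_le _) (hTG h)
    have hW : ∀ e ∈ A ∪ T, ∀ v ∈ e, v ∈ W := by
      intro e he
      rcases Finset.mem_union.1 he with h | h
      · exact (hA e h).choose_spec.2.1.2.2
      · exact hTW e h
    have hlow := tauTriOn_le_card hG hW hTfree
    have hunion := Finset.card_union_le A T
    refine hno ⟨A ∪ T, hG, hW, by omega, ?_⟩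
    have hout : ∀ a b c : V, G.Adj a b → G.Adj a c → G.Adj b c →
        a ∈ W → b ∈ W → c ∉ W → s(a, b) ∈ A ∪ T := fun a b c hab hac hbc ha hb hc =>
      Finset.mem_union_left _ (Finset.mem_filter.2
        ⟨Finset.mem_univ _, _, isTriangleThrough_of_adj hab hac hbc ha hb hc⟩)
    intro a b c hab hac hbc hmem
    by_cases ha : a ∈ W <;> by_cases hb : b ∈ W <;> by_cases hc : c ∈ W
    · by_contra! hnot
      exact (induce_cliqueFree_three_iff _ _).1 hTfree a ha b hb c hc
        (deleteEdges_adj.2 ⟨hab, hnot.1⟩) (deleteEdges_adj.2 ⟨hac, hnot.2.1⟩)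
        (deleteEdges_adj.2 ⟨hbc, hnot.2.2⟩)
    · exact Or.inl (hout a b c hab hac hbc ha hb hc)
    · exact Or.inr (Or.inl (hout a c b hac hab hbc.symm ha hc hb))
    · simp_all
    · exact Or.inr (Or.inr (hout b c a hbc hab.symm hac.symm hb hc ha))
    all_goals simp_all
end

section
/- Let φ be a Boolean formula in 3-CNF with variables x_1,…,x_n and clauses C_1,…,C_m, each clause containing exactly three pairwise distinct variables, and let G and 𝓗 be the graph and the triangle family produced by the following construction. For each variable x_i, create a triangle X_i on vertices {x_i^1, x_i^2, x_i^3} with distinguished edges x_i^T = {x_i^1, x_i^2} and x_i^F = {x_i^2, x_i^3}, and add X_i to 𝓗. For each clause C_j, create a triangle Y_j on new vertices {c_j^1, c_j^2, c_j^3}, associating its three edges one-to-one with the three literals of C_j. For each literal of C_j over variable x_i with associated Y_j-edge {u,v}: if the literal is positive, add edges so that A_ij := {u, v, x_i^1} and B_ij := {v, x_i^1, x_i^2} are triangles; if it is negative, add edges so that A_ij := {u, v, x_i^3} and B_ij := {v, x_i^3, x_i^2} are triangles; add A_ij to 𝓗. Then the triangles in 𝓗 are pairwise edge-disjoint, and G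 has a triangle-free deletion set of size |𝓗| = n + 3m if and only if φ is satisfiable. -/
open SimpleGraph

/-- Vertices of the construction: a triangle `X_i` on `(i,1),(i,2),(i,3)` for each
variable `x_i` (left summand) and a triangle `Y_j` on `(j,1),(j,2),(j,3)` for each
clause `C_j` (right summand). -/
abbrev TDVert (n m : ℕ) := (Fin n × Fin 3) ⊕ (Fin m × Fin 3)

/-- The graph of Construction 1: variable triangles `X_i`, clause triangles `Y_j`, and,
for the literal at position `a` of clause `C_j` over variable `x_i` with the associated
`Y_j`-edge `{u,v} = {(j,a),(j,a+1)}`, the connector triangles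
`A_ij = {u, v, x_i^1}` and `B_ij = {v, x_i^1, x_i^2}` (if the literal is positive) or
`A_ij = {u, v, x_i^3}` and `B_ij = {v, x_i^3, x_i^2}` (if the literal is negative).
Here `x_i^T = {x_i^1, x_i^2} = {(i,0),(i,1)}` and `x_i^F = {x_i^2, x_i^3} = {(i,1),(i,2)}`. -/
def tdGraph (n m : ℕ) (C : Fin m → Fin 3 → Fin n × Bool) : SimpleGraph (TDVert n m) :=
  SimpleGraph.fromRel (fun u v =>
    (∃ i : Fin n, ∃ a b : Fin 3, u = Sum.inl (i, a) ∧ v = Sum.inl (i, b)) ∨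
    (∃ j : Fin m, ∃ a b : Fin 3, u = Sum.inr (j, a) ∧ v = Sum.inr (j, b)) ∨
    (∃ j : Fin m, ∃ a : Fin 3,
      (u = Sum.inr (j, a) ∧
        v = Sum.inl ((C j a).1, if (C j a).2 then (0 : Fin 3) else 2)) ∨
      (u = Sum.inr (j, a + 1) ∧
        v = Sum.inl ((C j a).1, if (C j a).2 then (0 : Fin 3) else 2)) ∨
      (u = Sum.inr (j, a + 1) ∧ v = Sum.inl ((C j a).1, 1))))

/-- The variable triangle `X_i`. -/
def Xtri (n m : ℕ) (i : Fin n) : Finset (TDVert n m) :=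
  {Sum.inl (i, 0), Sum.inl (i, 1), Sum.inl (i, 2)}

/-- The connector triangle `A_ij` for the literal at position `a` of clause `C_j`. -/
def Atri (n m : ℕ) (C : Fin m → Fin 3 → Fin n × Bool) (j : Fin m) (a : Fin 3) :
    Finset (TDVert n m) :=
  {Sum.inr (j, a), Sum.inr (j, a + 1),
   Sum.inl ((C j a).1, if (C j a).2 then (0 : Fin 3) else 2)}

/-- The packing `𝓗`: all variable triangles `X_i` and all connector triangles `A_ij`. -/
def tdPacking (n m : ℕ) (C : Fin m → Fin 3 → Fin n × Bool) :
    Finset (Finset (TDVert n m)) :=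
  (Finset.univ.image fun i : Fin n => Xtri n m i) ∪
    (Finset.univ.image fun p : Fin m × Fin 3 => Atri n m C p.1 p.2)

/-- The endpoint (`x_i^1` or `x_i^3`) of the variable triangle used by a literal of given sign. -/
abbrev litEnd (b : Bool) : Fin 3 := if b then 0 else 2

lemma litEnd_ne_one (b : Bool) : litEnd b ≠ 1 := by cases b <;> decide

section Adjacency

variable {n m : ℕ} {C : Fin m → Fin 3 → Fin n × Bool}

lemma tdGraph_adj_inl_inl {i i' : Fin n} {a b : Fin 3} :
    (tdGraph n m C).Adj (Sum.inl (i, a)) (Sum.inl (i', b)) ↔ i = i' ∧ a ≠ b := by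
  simp only [tdGraph, fromRel_adj]
  simp
  grind

lemma tdGraph_adj_inr_inr {j j' : Fin m} {a b : Fin 3} :
    (tdGraph n m C).Adj (Sum.inr (j, a)) (Sum.inr (j', b)) ↔ j = j' ∧ a ≠ b := by
  simp only [tdGraph, fromRel_adj]
  simp
  grind

lemma tdGraph_adj_inr_inl {j : Fin m} {i : Fin n} {b k : Fin 3} :
    (tdGraph n m C).Adj (Sum.inr (j, b)) (Sum.inl (i, k)) ↔
      ∃ a, i = (C j a).1 ∧
        ((b = a ∧ k = litEnd (C j a).2) ∨ (b = a + 1 ∧ k = litEnd (C j a).2) ∨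
          (b = a + 1 ∧ k = 1)) := by
  simp only [tdGraph, fromRel_adj]
  simp
  grind

end Adjacency

/-- The triangles of the packing, indexed by variables and by literal occurrences. -/
def packingTri (n m : ℕ) (C : Fin m → Fin 3 → Fin n × Bool) :
    Fin n ⊕ (Fin m × Fin 3) → Finset (TDVert n m)
  | Sum.inl i => Xtri n m i
  | Sum.inr p => Atri n m C p.1 p.2

lemma tdPacking_eq_image (n m : ℕ) (C : Fin m → Fin 3 → Fin n × Bool) :
    tdPacking n m C = Finset.univ.image (packingTri n m C) := by
  ext t
  simp [tdPacking, packingTri]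

lemma packingTri_isNClique (n m : ℕ) (C : Fin m → Fin 3 → Fin n × Bool)
    (x : Fin n ⊕ (Fin m × Fin 3)) : (tdGraph n m C).IsNClique 3 (packingTri n m C x) := by
  rw [is3Clique_iff]
  rcases x with i | ⟨j, a⟩
  · exact ⟨_, _, _, by simp [tdGraph_adj_inl_inl], by simp [tdGraph_adj_inl_inl],
      by simp [tdGraph_adj_inl_inl], rfl⟩
  · exact ⟨_, _, _, by simp [tdGraph_adj_inr_inr],
      tdGraph_adj_inr_inl.2 ⟨a, rfl, Or.inl ⟨rfl, rfl⟩⟩,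
      tdGraph_adj_inr_inl.2 ⟨a, rfl, Or.inr (Or.inl ⟨rfl, rfl⟩)⟩, rfl⟩

/-- Two triangles of the packing that share two vertices coincide. -/
lemma packingTri_index_eq {n m : ℕ} {C : Fin m → Fin 3 → Fin n × Bool}
    (hC : ∀ j : Fin m, Function.Injective fun a : Fin 3 => (C j a).1)
    {x y : Fin n ⊕ (Fin m × Fin 3)} {u v : TDVert n m} (huv : u ≠ v)
    (hux : u ∈ packingTri n m C x) (hvx : v ∈ packingTri n m C x)
    (huy : u ∈ packingTri n m C y) (hvy : v ∈ packingTri n m C y) : x = y := by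
  have hvar : ∀ j a b, (C j a).1 = (C j b).1 → a = b := fun j _ _ h => hC j h
  rcases x with i | ⟨j, a⟩ <;> rcases y with i' | ⟨j', a'⟩ <;>
    rcases u with ⟨iu, ku⟩ | ⟨ju, ku⟩ <;> rcases v with ⟨iv, kv⟩ | ⟨jv, kv⟩ <;>
    simp only [packingTri, Xtri, Atri, Finset.mem_insert, Finset.mem_singleton, Sum.inl.injEq,
      Sum.inr.injEq, Prod.mk.injEq, reduceCtorEq, false_or, or_false, or_self, ne_eq]
      at huv hux hvx huy hvy
  all_goals grind

lemma packingTri_injective {n m : ℕ} {C : Fin m → Fin 3 → Fin n × Bool}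
    (hC : ∀ j : Fin m, Function.Injective fun a : Fin 3 => (C j a).1) :
    Function.Injective (packingTri n m C) := by
  intro x y hxy
  obtain ⟨u, hu, v, hv, huv⟩ := Finset.one_lt_card.1
    (by rw [(packingTri_isNClique n m C x).card_eq]; norm_num : 1 < (packingTri n m C x).card)
  exact packingTri_index_eq hC huv hu hv (hxy ▸ hu) (hxy ▸ hv)

/-- If a set `S` of as many edges as there are triangles in an edge-disjoint family hits every
triangle of the family, then every edge of `S` lies in a triangle of the family, and no triangle
contains two edges of `S`. -/
lemma tight_hitting_set {ι V : Type*} [Fintype ι] {T : ι → Finset V} {S : Finset (Sym2 V)}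
    (hT : ∀ x y u v, u ≠ v → u ∈ T x → v ∈ T x → u ∈ T y → v ∈ T y → x = y)
    (hS : S.card = Fintype.card ι)
    (hit : ∀ x, ∃ u ∈ T x, ∃ v ∈ T x, u ≠ v ∧ s(u, v) ∈ S) :
    (∀ u v, s(u, v) ∈ S → ∃ x, u ∈ T x ∧ v ∈ T x) ∧
    (∀ x u v u' v', u ≠ v → u' ≠ v' → s(u, v) ∈ S → s(u', v') ∈ S →
      u ∈ T x → v ∈ T x → u' ∈ T x → v' ∈ T x → s(u, v) = s(u', v')) := by
  classical
  choose f hf g hg hfg hfgS using hit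
  have inj : Function.Injective fun x => s(f x, g x) := by
    intro x y hxy
    rcases Sym2.eq_iff.1 hxy with ⟨h1, h2⟩ | ⟨h1, h2⟩
    · exact hT x y _ _ (hfg x) (hf x) (hg x) (h1 ▸ hf y) (h2 ▸ hg y)
    · exact hT x y _ _ (hfg x) (hf x) (hg x) (h1 ▸ hg y) (h2 ▸ hf y)
  have himg : Finset.univ.image (fun x => s(f x, g x)) = S := by
    apply Finset.eq_of_subset_of_card_le
    · simpa [Finset.subset_iff] using hfgS
    · rw [Finset.card_image_of_injective _ inj, hS, Finset.card_univ]
  have surj : ∀ u v, s(u, v) ∈ S → ∃ x, s(f x, g x) = s(u, v) ∧ u ∈ T x ∧ v ∈ T x := by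
    intro u v h
    rw [← himg] at h
    obtain ⟨x, -, hx⟩ := Finset.mem_image.1 h
    refine ⟨x, hx, ?_⟩
    rcases Sym2.eq_iff.1 hx with ⟨rfl, rfl⟩ | ⟨rfl, rfl⟩
    · exact ⟨hf x, hg x⟩
    · exact ⟨hg x, hf x⟩
  refine ⟨fun u v h => (surj u v h).imp fun _ => And.right, ?_⟩
  intro x u v u' v' huv huv' h h' hu hv hu' hv'
  obtain ⟨y, hy, hyu, hyv⟩ := surj u v h
  obtain ⟨y', hy', hyu', hyv'⟩ := surj u' v' h'
  rw [← hy, ← hy', ← hT x y u v huv hu hv hyu hyv, ← hT x y' u' v' huv' hu' hv' hyu' hyv']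

/-- A triangle-free deletion set contains one of the edges of each triangle. -/
lemma mem_of_deleteEdges_cliqueFree {V : Type*} {G : SimpleGraph V} {S : Set (Sym2 V)}
    (h : (G.deleteEdges S).CliqueFree 3) {a b c : V} (hab : G.Adj a b) (hac : G.Adj a c)
    (hbc : G.Adj b c) : s(a, b) ∈ S ∨ s(a, c) ∈ S ∨ s(b, c) ∈ S := by
  classical
  by_contra! hn
  exact h {a, b, c} (is3Clique_triple_iff.2 (by simp [deleteEdges_adj, *]))

/-- A triangle-free deletion set of size `n + 3m` yields a satisfying assignment. -/
lemma exists_assignment_of_deletionSet {n m : ℕ} {C : Fin m → Fin 3 → Fin n × Bool}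
    (hC : ∀ j : Fin m, Function.Injective fun a : Fin 3 => (C j a).1)
    {S : Finset (Sym2 (TDVert n m))} (hcard : S.card = n + 3 * m)
    (hfree : ((tdGraph n m C).deleteEdges ↑S).CliqueFree 3) :
    ∃ σ : Fin n → Bool, ∀ j : Fin m, ∃ a : Fin 3, σ (C j a).1 = (C j a).2 := by
  classical
  obtain ⟨hcov, huniq⟩ := tight_hitting_set (T := packingTri n m C) (S := S)
    (fun x y u v => packingTri_index_eq hC) (by simp [hcard, mul_comm]) (by
      intro x
      obtain ⟨a, b, c, hab, hac, hbc, ht⟩ := is3Clique_iff.1 (packingTri_isNClique n m C x)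
      have := mem_of_deleteEdges_cliqueFree hfree hab hac hbc
      rw [ht]
      rcases this with h | h | h
      · exact ⟨a, by simp, b, by simp, hab.ne, h⟩
      · exact ⟨a, by simp, c, by simp, hac.ne, h⟩
      · exact ⟨b, by simp, c, by simp, hbc.ne, h⟩)
  have hY : ∀ j, ∃ a, s(Sum.inr (j, a), Sum.inr (j, a + 1)) ∈ S := by
    intro j
    rcases mem_of_deleteEdges_cliqueFree hfree
      (tdGraph_adj_inr_inr (j := j) (a := 0) (b := 1) |>.2 ⟨rfl, by decide⟩)
      (tdGraph_adj_inr_inr (j := j) (a := 0) (b := 2) |>.2 ⟨rfl, by decide⟩)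
      (tdGraph_adj_inr_inr (j := j) (a := 1) (b := 2) |>.2 ⟨rfl, by decide⟩) with h | h | h
    · exact ⟨0, h⟩
    · exact ⟨2, by rw [Sym2.eq_swap]; exact h⟩
    · exact ⟨1, h⟩
  have hlit : ∀ j a, s(Sum.inr (j, a), Sum.inr (j, a + 1)) ∈ S →
      s(Sum.inl ((C j a).1, litEnd (C j a).2), Sum.inl ((C j a).1, 1)) ∈ S := by
    intro j a h
    rcases mem_of_deleteEdges_cliqueFree hfree
      (tdGraph_adj_inr_inl.2 ⟨a, rfl, Or.inr (Or.inl ⟨rfl, rfl⟩)⟩)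
      (tdGraph_adj_inr_inl.2 ⟨a, rfl, Or.inr (Or.inr ⟨rfl, rfl⟩)⟩)
      (tdGraph_adj_inl_inl.2 ⟨rfl, litEnd_ne_one (C j a).2⟩) with h' | h' | h'
    · have := huniq (Sum.inr (j, a)) _ _ _ _ (by simp) (by simp) h h'
        (by simp [packingTri, Atri]) (by simp [packingTri, Atri]) (by simp [packingTri, Atri])
        (by simp [packingTri, Atri])
      simp at this
    · obtain ⟨x, hx1, hx2⟩ := hcov _ _ h'
      rcases x with i | ⟨j', a'⟩
      · simp [packingTri, Xtri] at hx1
      · simp only [packingTri, Atri, Finset.mem_insert, Finset.mem_singleton, reduceCtorEq,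
          false_or, Sum.inl.injEq, Prod.mk.injEq] at hx2
        exact absurd hx2.2.symm (litEnd_ne_one _)
    · exact h'
  refine ⟨fun i => decide (s(Sum.inl (i, litEnd true), Sum.inl (i, 1)) ∈ S), fun j => ?_⟩
  obtain ⟨a, ha⟩ := hY j
  have h := hlit j a ha
  refine ⟨a, ?_⟩
  rcases hs : (C j a).2 with _ | _
  · rw [hs] at h
    rw [decide_eq_false_iff_not]
    intro h'
    have := huniq (Sum.inl (C j a).1) _ _ _ _ (by simp [litEnd]) (by simp [litEnd]) h h'
      (by simp [packingTri, Xtri]) (by simp [packingTri, Xtri]) (by simp [packingTri, Xtri])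
      (by simp [packingTri, Xtri])
    simp [litEnd] at this
  · rw [hs] at h
    exact decide_eq_true h

/-- The edge of a packing triangle deleted for the assignment `σ`. -/
def assignmentEdge {n m : ℕ} (C : Fin m → Fin 3 → Fin n × Bool) (σ : Fin n → Bool) :
    Fin n ⊕ (Fin m × Fin 3) → Sym2 (TDVert n m)
  | Sum.inl i => s(Sum.inl (i, litEnd (σ i)), Sum.inl (i, 1))
  | Sum.inr (j, a) =>
    if σ (C j a).1 = (C j a).2 then s(Sum.inr (j, a), Sum.inr (j, a + 1))
    else s(Sum.inr (j, a + 1), Sum.inl ((C j a).1, litEnd (C j a).2))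

lemma exists_assignmentEdge_eq {n m : ℕ} (C : Fin m → Fin 3 → Fin n × Bool) (σ : Fin n → Bool)
    (x : Fin n ⊕ (Fin m × Fin 3)) : ∃ u ∈ packingTri n m C x, ∃ v ∈ packingTri n m C x,
      (tdGraph n m C).Adj u v ∧ assignmentEdge C σ x = s(u, v) := by
  rcases x with i | ⟨j, a⟩
  · refine ⟨_, ?_, _, ?_, tdGraph_adj_inl_inl.2 ⟨rfl, litEnd_ne_one (σ i)⟩, rfl⟩
    · cases σ i <;> simp [packingTri, Xtri]
    · simp [packingTri, Xtri]
  · by_cases h : σ (C j a).1 = (C j a).2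
    · exact ⟨Sum.inr (j, a), by simp [packingTri, Atri], Sum.inr (j, a + 1),
        by simp [packingTri, Atri], tdGraph_adj_inr_inr.2 (by simp), by simp [assignmentEdge, h]⟩
    · exact ⟨Sum.inr (j, a + 1), by simp [packingTri, Atri],
        Sum.inl ((C j a).1, litEnd (C j a).2), by simp [packingTri, Atri],
        tdGraph_adj_inr_inl.2 ⟨a, rfl, Or.inr (Or.inl ⟨rfl, rfl⟩)⟩, by simp [assignmentEdge, h]⟩

/-- A satisfying assignment yields a triangle-free deletion set of size `n + 3m`. -/
lemma exists_deletionSet_of_assignment {n m : ℕ} {C : Fin m → Fin 3 → Fin n × Bool}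
    (hC : ∀ j : Fin m, Function.Injective fun a : Fin 3 => (C j a).1) {σ : Fin n → Bool}
    (hσ : ∀ j : Fin m, ∃ a : Fin 3, σ (C j a).1 = (C j a).2) :
    ∃ S : Finset (Sym2 (TDVert n m)), ↑S ⊆ (tdGraph n m C).edgeSet ∧
      S.card = n + 3 * m ∧ ((tdGraph n m C).deleteEdges ↑S).CliqueFree 3 := by
  classical
  set S := Finset.univ.image (assignmentEdge C σ) with hS
  have hmem : ∀ x, assignmentEdge C σ x ∈ S := fun x => by simp [hS]
  have hvar : ∀ i, s(Sum.inl (i, litEnd (σ i)), Sum.inl (i, 1)) ∈ S := fun i => hmem (Sum.inl i)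
  have hsat : ∀ j a, σ (C j a).1 = (C j a).2 → s(Sum.inr (j, a), Sum.inr (j, a + 1)) ∈ S :=
    fun j a h => by simpa [assignmentEdge, h] using hmem (Sum.inr (j, a))
  have hunsat : ∀ j a, σ (C j a).1 ≠ (C j a).2 →
      s(Sum.inr (j, a + 1), Sum.inl ((C j a).1, litEnd (C j a).2)) ∈ S :=
    fun j a h => by simpa [assignmentEdge, h] using hmem (Sum.inr (j, a))
  refine ⟨S, ?_, ?_, ?_⟩
  · intro e he
    obtain ⟨x, -, rfl⟩ := Finset.mem_image.1 (Finset.mem_coe.1 he)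
    obtain ⟨u, -, v, -, h, he⟩ := exists_assignmentEdge_eq C σ x
    rwa [he, mem_edgeSet]
  · rw [hS, Finset.card_image_of_injective, Finset.card_univ]
    · simp [mul_comm]
    · intro x y hxy
      obtain ⟨u, hu, v, hv, h, he⟩ := exists_assignmentEdge_eq C σ x
      obtain ⟨u', hu', v', hv', -, he'⟩ := exists_assignmentEdge_eq C σ y
      rw [he, he'] at hxy
      rcases Sym2.eq_iff.1 hxy with ⟨rfl, rfl⟩ | ⟨rfl, rfl⟩
      · exact packingTri_index_eq hC h.ne hu hv hu' hv'
      · exact packingTri_index_eq hC h.ne hu hv hv' hu'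
  set G := (tdGraph n m C).deleteEdges (S : Set (Sym2 (TDVert n m))) with hG
  have hadj : ∀ {u v}, G.Adj u v → (tdGraph n m C).Adj u v ∧ s(u, v) ∉ S := fun h => by
    simpa [hG, deleteEdges_adj] using h
  have hXXX : ∀ p q r : Fin n × Fin 3, G.Adj (Sum.inl p) (Sum.inl q) →
      G.Adj (Sum.inl p) (Sum.inl r) → G.Adj (Sum.inl q) (Sum.inl r) → False := by
    rintro ⟨i, a⟩ ⟨i', b⟩ ⟨i'', c⟩ h1 h2 h3
    obtain ⟨h1, h1S⟩ := hadj h1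
    obtain ⟨h2, h2S⟩ := hadj h2
    obtain ⟨h3, h3S⟩ := hadj h3
    obtain ⟨rfl, hab⟩ := tdGraph_adj_inl_inl.1 h1
    obtain ⟨rfl, hac⟩ := tdGraph_adj_inl_inl.1 h2
    obtain ⟨-, hbc⟩ := tdGraph_adj_inl_inl.1 h3
    have h := hvar i
    have h' := h
    rw [Sym2.eq_swap] at h'
    have := litEnd_ne_one (σ i)
    generalize litEnd (σ i) = e at *
    have : ∀ a b c e : Fin 3, a ≠ b → a ≠ c → b ≠ c → e ≠ 1 →
        (a = e ∧ b = 1) ∨ (a = 1 ∧ b = e) ∨ (a = e ∧ c = 1) ∨ (a = 1 ∧ c = e) ∨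
        (b = e ∧ c = 1) ∨ (b = 1 ∧ c = e) := by decide
    rcases this a b c e hab hac hbc ‹_› with ⟨rfl, rfl⟩ | ⟨rfl, rfl⟩ | ⟨rfl, rfl⟩ | ⟨rfl, rfl⟩ |
      ⟨rfl, rfl⟩ | ⟨rfl, rfl⟩ <;> contradiction
  have hYYY : ∀ p q r : Fin m × Fin 3, G.Adj (Sum.inr p) (Sum.inr q) →
      G.Adj (Sum.inr p) (Sum.inr r) → G.Adj (Sum.inr q) (Sum.inr r) → False := by
    rintro ⟨j, a⟩ ⟨j', b⟩ ⟨j'', c⟩ h1 h2 h3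
    obtain ⟨h1, h1S⟩ := hadj h1
    obtain ⟨h2, h2S⟩ := hadj h2
    obtain ⟨h3, h3S⟩ := hadj h3
    obtain ⟨rfl, hab⟩ := tdGraph_adj_inr_inr.1 h1
    obtain ⟨rfl, hac⟩ := tdGraph_adj_inr_inr.1 h2
    obtain ⟨-, hbc⟩ := tdGraph_adj_inr_inr.1 h3
    obtain ⟨d, hd⟩ := hσ j
    have h := hsat j d hd
    have h' := h
    rw [Sym2.eq_swap] at h'
    have : ∀ a b c d : Fin 3, a ≠ b → a ≠ c → b ≠ c →
        (a = d ∧ b = d + 1) ∨ (a = d + 1 ∧ b = d) ∨ (a = d ∧ c = d + 1) ∨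
        (a = d + 1 ∧ c = d) ∨ (b = d ∧ c = d + 1) ∨ (b = d + 1 ∧ c = d) := by decide
    rcases this a b c d hab hac hbc with ⟨rfl, rfl⟩ | ⟨rfl, rfl⟩ | ⟨rfl, rfl⟩ | ⟨rfl, rfl⟩ |
      ⟨rfl, rfl⟩ | ⟨rfl, rfl⟩ <;> contradiction
  have hB : ∀ j a, s(Sum.inr (j, a + 1), Sum.inl ((C j a).1, litEnd (C j a).2)) ∉ S →
      s(Sum.inl ((C j a).1, litEnd (C j a).2), Sum.inl ((C j a).1, 1)) ∈ S := by
    intro j a h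
    rw [← of_not_not (mt (hunsat j a) h)]
    exact hvar _
  have hYXX : ∀ (p : Fin m × Fin 3) (q r : Fin n × Fin 3), G.Adj (Sum.inr p) (Sum.inl q) →
      G.Adj (Sum.inr p) (Sum.inl r) → G.Adj (Sum.inl q) (Sum.inl r) → False := by
    rintro ⟨j, b⟩ ⟨i, k⟩ ⟨i', k'⟩ h1 h2 h3
    obtain ⟨h1, h1S⟩ := hadj h1
    obtain ⟨h2, h2S⟩ := hadj h2
    obtain ⟨h3, h3S⟩ := hadj h3
    obtain ⟨rfl, hk⟩ := tdGraph_adj_inl_inl.1 h3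
    obtain ⟨a, rfl, hqa⟩ := tdGraph_adj_inr_inl.1 h1
    obtain ⟨a', ha, hra⟩ := tdGraph_adj_inr_inl.1 h2
    obtain rfl : a = a' := hC j ha
    have hne : a ≠ a + 1 := by simp
    have hS' := hB j a
    rcases hqa with ⟨rfl, rfl⟩ | ⟨rfl, rfl⟩ | ⟨rfl, rfl⟩ <;>
      rcases hra with ⟨hb, rfl⟩ | ⟨hb, rfl⟩ | ⟨hb, rfl⟩ <;>
      first
      | exact absurd rfl hk
      | exact hne hb
      | exact hne hb.symm
      | exact h3S (hS' h1S)
      | exact h3S (by rw [Sym2.eq_swap]; exact hS' h2S)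
  have hXYY : ∀ (p : Fin n × Fin 3) (q r : Fin m × Fin 3), G.Adj (Sum.inr q) (Sum.inl p) →
      G.Adj (Sum.inr r) (Sum.inl p) → G.Adj (Sum.inr q) (Sum.inr r) → False := by
    rintro ⟨i, k⟩ ⟨j, b⟩ ⟨j', b'⟩ h1 h2 h3
    obtain ⟨h1, h1S⟩ := hadj h1
    obtain ⟨h2, h2S⟩ := hadj h2
    obtain ⟨h3, h3S⟩ := hadj h3
    obtain ⟨rfl, hb⟩ := tdGraph_adj_inr_inr.1 h3
    obtain ⟨a, rfl, hqa⟩ := tdGraph_adj_inr_inl.1 h1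
    obtain ⟨a', ha, hra⟩ := tdGraph_adj_inr_inl.1 h2
    obtain rfl : a = a' := hC j ha
    have hS' : s(Sum.inr (j, a + 1), Sum.inl ((C j a).1, litEnd (C j a).2)) ∉ S →
        s(Sum.inr (j, a), Sum.inr (j, a + 1)) ∈ S :=
      fun h => hsat j a (of_not_not (mt (hunsat j a) h))
    have hne := litEnd_ne_one (C j a).2
    rcases hqa with ⟨rfl, rfl⟩ | ⟨rfl, rfl⟩ | ⟨rfl, rfl⟩ <;>
      rcases hra with ⟨rfl, hk⟩ | ⟨rfl, hk⟩ | ⟨rfl, hk⟩ <;>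
      first
      | exact absurd rfl hb
      | exact hne hk
      | exact hne hk.symm
      | exact h3S (hS' h2S)
      | exact h3S (by rw [Sym2.eq_swap]; exact hS' h1S)
  intro t ht
  obtain ⟨u, v, w, huv, huw, hvw, -⟩ := is3Clique_iff.1 ht
  rcases u with u | u <;> rcases v with v | v <;> rcases w with w | w
  · exact hXXX u v w huv huw hvw
  · exact hYXX w u v huw.symm hvw.symm huv
  · exact hYXX v u w huv.symm hvw huw
  · exact hXYY u v w huv.symm huw.symm hvw
  · exact hYXX u v w huv huw hvw
  · exact hXYY v u w huv hvw.symm huw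
  · exact hXYY w u v huw hvw huv
  · exact hYYY u v w huv huw hvw

/-- Theorem 2 / Construction 1 of the paper. For a 3-CNF formula `φ`
(clause `j` has literals `C j 0, C j 1, C j 2`, each literal being a pair of a variable
and a sign, with pairwise distinct variables in each clause), the construction yields a
graph `G` and a family `𝓗` of `n + 3m` triangles of `G` that are pairwise edge-disjoint,
such that `G` has a triangle-free deletion set of size `|𝓗| = n + 3m` iff `φ` is
satisfiable. -/
theorem stmt4 (n m : ℕ) (C : Fin m → Fin 3 → Fin n × Bool)
    (hC : ∀ j : Fin m, Function.Injective fun a : Fin 3 => (C j a).1) :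
    (∀ t ∈ tdPacking n m C, (tdGraph n m C).IsNClique 3 t) ∧
    (∀ t₁ ∈ tdPacking n m C, ∀ t₂ ∈ tdPacking n m C, t₁ ≠ t₂ → (t₁ ∩ t₂).card ≤ 1) ∧
    (tdPacking n m C).card = n + 3 * m ∧
    ((∃ S : Finset (Sym2 (TDVert n m)), ↑S ⊆ (tdGraph n m C).edgeSet ∧
        S.card = n + 3 * m ∧ ((tdGraph n m C).deleteEdges ↑S).CliqueFree 3) ↔
      (∃ σ : Fin n → Bool, ∀ j : Fin m, ∃ a : Fin 3, σ (C j a).1 = (C j a).2)) := by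
  rw [tdPacking_eq_image]
  refine ⟨?_, ?_, ?_, ?_, ?_⟩
  · intro t ht
    obtain ⟨x, -, rfl⟩ := Finset.mem_image.1 ht
    exact packingTri_isNClique n m C x
  · intro t₁ h₁ t₂ h₂ hne
    obtain ⟨x, -, rfl⟩ := Finset.mem_image.1 h₁
    obtain ⟨y, -, rfl⟩ := Finset.mem_image.1 h₂
    by_contra! hlt
    obtain ⟨u, hu, v, hv, huv⟩ := Finset.one_lt_card.1 hlt
    rw [Finset.mem_inter] at hu hv
    exact hne (congrArg _ (packingTri_index_eq hC huv hu.1 hv.1 hu.2 hv.2))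
  · rw [Finset.card_image_of_injective _ (packingTri_injective hC), Finset.card_univ]
    simp [mul_comm]
  · rintro ⟨S, -, hcard, hfree⟩
    exact exists_assignment_of_deletionSet hC hcard hfree
  · rintro ⟨σ, hσ⟩
    exact exists_deletionSet_of_assignment hC hσ
end

section
/- Let G = (V,A) be a tournament, let H = (W,F) be an induced subtournament of G, and let T ⊆ F be a minimum feedback arc set of H (so |T| = τ(H)) such that in the tournament G′ obtained from G by reversing the arcs of T, no directed triangle contains an arc with both endpoints in W. Then for every k ≥ τ(H): G has a feedback arc set of size at most k if and only if G′ has a feedback arc set of size at most k − τ(H); in particular, there is a minimum-size feedback arc set of G containing T. -/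
/-- A tournament on `V`: an irreflexive relation such that for distinct vertices exactly
one of the two opposite arcs is present. -/
def IsTournament {V : Type*} (r : V → V → Prop) : Prop :=
  (∀ v, ¬ r v v) ∧ ∀ u v : V, u ≠ v → (r u v ↔ ¬ r v u)

/-- The relation obtained from `r` by reversing the arcs in `S`. -/
def reverseArcs {V : Type*} (r : V → V → Prop) (S : Set (V × V)) : V → V → Prop :=
  fun u v => (r u v ∧ (u, v) ∉ S) ∨ (r v u ∧ (v, u) ∈ S)

/-- A relation is acyclic if it has no directed cycle. -/
def RelAcyclic {V : Type*} (r : V → V → Prop) : Prop :=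
  ∀ v, ¬ Relation.TransGen r v v

/-- `S` is a feedback arc set of the tournament `r`: a set of arcs whose reversal yields
an acyclic tournament. -/
def IsFAS {V : Type*} (r : V → V → Prop) (S : Set (V × V)) : Prop :=
  (∀ p ∈ S, r p.1 p.2) ∧ RelAcyclic (reverseArcs r S)

/-- `τ` of the subtournament induced by `W`: the minimum size of a feedback arc set of
the restriction of `r` to `W`. -/
noncomputable def tauFASOn {V : Type*} [Fintype V] [DecidableEq V]
    (r : V → V → Prop) (W : Finset V) : ℕ :=
  sInf {n | ∃ T : Finset (V × V), (∀ p ∈ T, p.1 ∈ W ∧ p.2 ∈ W ∧ r p.1 p.2) ∧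
    T.card = n ∧ RelAcyclic (fun u v => u ∈ W ∧ v ∈ W ∧ reverseArcs r ↑T u v)}

/-- A finite acyclic relation admits a strictly increasing numbering. -/
theorem RelAcyclic.exists_rank {V : Type*} [Finite V] {q : V → V → Prop} (hq : RelAcyclic q) :
    ∃ π : V → ℕ, ∀ u v, q u v → π u < π v := by
  refine ⟨fun v => {u | Relation.TransGen q u v}.ncard, fun u v huv => ?_⟩
  refine Set.ncard_lt_ncard ?_ (Set.toFinite _)
  have hsub : {w | Relation.TransGen q w u} ⊆ {w | Relation.TransGen q w v} :=
    fun w hw => Relation.TransGen.tail hw huv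
  exact (Set.ssubset_iff_of_subset hsub).2 ⟨u, Relation.TransGen.single huv, hq u⟩

theorem relAcyclic_of_rank {V : Type*} {q : V → V → Prop} (π : V → ℕ)
    (h : ∀ u v, q u v → π u < π v) : RelAcyclic q := by
  have key : ∀ u v, Relation.TransGen q u v → π u < π v := by
    intro u v huv
    induction huv with
    | single h1 => exact h _ _ h1
    | tail _ h1 ih => exact ih.trans (h _ _ h1)
  exact fun v hv => lt_irrefl _ (key v v hv)

theorem IsTournament.reverseArcs {V : Type*} {r : V → V → Prop} (hr : IsTournament r)
    (S : Set (V × V)) : IsTournament (reverseArcs r S) := by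
  refine ⟨fun v => ?_, fun u v huv => ?_⟩
  · have := hr.1 v
    simp only [_root_.reverseArcs]
    tauto
  · have := hr.2 u v huv
    simp only [_root_.reverseArcs]
    tauto

theorem IsTournament.injective_of_rank {V : Type*} {q : V → V → Prop} (hq : IsTournament q)
    {π : V → ℕ} (h : ∀ u v, q u v → π u < π v) : Function.Injective π := by
  intro u v huv
  by_contra hne
  by_cases h1 : q u v
  · exact (h u v h1).ne huv
  · have h2 : q v u := by
      have := hq.2 u v hne
      tauto
    exact (h v u h2).ne huv.symm

section BackArcs

variable {V : Type*} [Fintype V]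

open Classical in
/-- The arcs of `r` that go backwards in the numbering `π`. -/
noncomputable def backArcs (r : V → V → Prop) (π : V → ℕ) : Finset (V × V) :=
  Finset.univ.filter fun p => r p.1 p.2 ∧ π p.2 < π p.1

theorem mem_backArcs {r : V → V → Prop} {π : V → ℕ} {p : V × V} :
    p ∈ backArcs r π ↔ r p.1 p.2 ∧ π p.2 < π p.1 := by
  simp [backArcs]

theorem IsTournament.rank_lt_of_reverseArcs_backArcs {r : V → V → Prop} (hr : IsTournament r)
    {π : V → ℕ} (hπ : Function.Injective π) {u v : V}
    (h : _root_.reverseArcs r (backArcs r π : Set (V × V)) u v) : π u < π v := by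
  simp only [_root_.reverseArcs, Finset.mem_coe, mem_backArcs] at h
  rcases h with ⟨h1, h2⟩ | ⟨_, _, h2⟩
  · have hne : u ≠ v := by
      rintro rfl
      exact hr.1 u h1
    have := hπ.ne hne
    by_contra h3
    exact h2 ⟨h1, by omega⟩
  · exact h2

theorem IsTournament.isFAS_backArcs {r : V → V → Prop} (hr : IsTournament r)
    {π : V → ℕ} (hπ : Function.Injective π) : IsFAS r (backArcs r π : Set (V × V)) :=
  ⟨fun _ hp => (mem_backArcs.1 (Finset.mem_coe.1 hp)).1,
    relAcyclic_of_rank π fun _ _ h => hr.rank_lt_of_reverseArcs_backArcs hπ h⟩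

theorem backArcs_subset {r : V → V → Prop} {π : V → ℕ} {S : Finset (V × V)}
    (h : ∀ u v, reverseArcs r (S : Set (V × V)) u v → π u < π v) : backArcs r π ⊆ S := by
  intro p hp
  rw [mem_backArcs] at hp
  by_contra hS
  exact absurd (h p.1 p.2 (Or.inl ⟨hp.1, hS⟩)) (by omega)

end BackArcs

/-- The values that `π` takes on `W` can be rearranged to increase with `f`. -/
theorem exists_rearrangement {V : Type*} [DecidableEq V] (W : Finset V) {f π : V → ℕ}
    (hf : Set.InjOn f W) (hπ : Function.Injective π) :
    ∃ σ : V → ℕ, Function.Injective σ ∧ (∀ v, v ∉ W → σ v = π v) ∧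
      W.image σ = W.image π ∧ ∀ u ∈ W, ∀ v ∈ W, f u < f v → σ u < σ v := by
  have h1 : (W.image f).card = W.card := Finset.card_image_of_injOn hf
  have h2 : (W.image π).card = W.card := Finset.card_image_of_injective _ hπ
  let e : W.image f ≃o W.image π :=
    ((W.image f).orderIsoOfFin h1).symm.trans ((W.image π).orderIsoOfFin h2)
  let σ : V → ℕ := fun v =>
    if h : v ∈ W then (e ⟨f v, Finset.mem_image_of_mem f h⟩ : ℕ) else π v
  have hσW : ∀ v (h : v ∈ W), σ v = e ⟨f v, Finset.mem_image_of_mem f h⟩ :=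
    fun v h => dif_pos h
  have hσ : ∀ v, v ∉ W → σ v = π v := fun v h => dif_neg h
  have hmem : ∀ v ∈ W, σ v ∈ W.image π := fun v h => by
    rw [hσW v h]
    exact (e _).2
  have hinj : Function.Injective σ := by
    intro u v huv
    by_cases hu : u ∈ W <;> by_cases hv : v ∈ W
    · rw [hσW u hu, hσW v hv] at huv
      have := e.injective (Subtype.ext huv)
      exact hf hu hv (congrArg Subtype.val this)
    · obtain ⟨w, hw, hwv⟩ := Finset.mem_image.1 (hmem u hu)
      rw [huv, hσ v hv] at hwv
      exact absurd (hπ hwv ▸ hw) hv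
    · obtain ⟨w, hw, hwv⟩ := Finset.mem_image.1 (hmem v hv)
      rw [← huv, hσ u hu] at hwv
      exact absurd (hπ hwv ▸ hw) hu
    · rw [hσ u hu, hσ v hv] at huv
      exact hπ huv
  refine ⟨σ, hinj, hσ, ?_, ?_⟩
  · refine Finset.eq_of_subset_of_card_le (Finset.image_subset_iff.2 hmem) ?_
    rw [h2, Finset.card_image_of_injective _ hinj]
  · intro u hu v hv huv
    rw [hσW u hu, hσW v hv]
    exact e.strictMono (Subtype.mk_lt_mk.2 huv)

theorem card_filter_lt_eq_of_image_eq {V : Type*} [DecidableEq V] {W : Finset V} {σ π : V → ℕ}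
    (hσ : Function.Injective σ) (hπ : Function.Injective π) (h : W.image σ = W.image π) (c : ℕ) :
    (W.filter fun w => σ w < c).card = (W.filter fun w => π w < c).card := by
  rw [← Finset.card_image_of_injective _ hσ, ← Finset.card_image_of_injective _ hπ,
    ← Finset.filter_image (p := fun x => x < c), ← Finset.filter_image (p := fun x => x < c), h]

theorem card_symmDiff_le_of_comparable {V : Type*} [DecidableEq V] {I A B : Finset V}
    (hcard : A.card = B.card) (h : I ⊆ A ∨ A ⊆ I) :
    (symmDiff I A).card ≤ (symmDiff I B).card := by
  have key : ∀ C : Finset V, (symmDiff I C).card = (I \ C).card + (C \ I).card := fun C => by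
    rw [symmDiff, Finset.sup_eq_union, Finset.card_union_of_disjoint disjoint_sdiff_sdiff]
  have hA := Finset.card_sdiff_add_card_inter I A
  have hA' := Finset.card_sdiff_add_card_inter A I
  have hB := Finset.card_sdiff_add_card_inter I B
  have hB' := Finset.card_sdiff_add_card_inter B I
  rw [Finset.inter_comm] at hA' hB'
  rw [key, key]
  rcases h with h | h
  · have := Finset.card_eq_zero.2 (Finset.sdiff_eq_empty_iff_subset.2 h)
    omega
  · have := Finset.card_eq_zero.2 (Finset.sdiff_eq_empty_iff_subset.2 h)
    omega

section Crossing

variable {V : Type*} [Fintype V] [DecidableEq V]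

/-- The back arcs not inside `W` are counted by the back arcs outside `W` and, for each vertex
outside `W`, the vertices of `W` misplaced relative to it. -/
theorem card_backArcs_not_inside {q : V → V → Prop} [DecidableRel q] (hq : IsTournament q)
    (W : Finset V) {π : V → ℕ} (hπ : Function.Injective π) :
    ((backArcs q π).filter fun p => ¬ (p.1 ∈ W ∧ p.2 ∈ W)).card =
      (∑ u ∈ Wᶜ, ∑ v ∈ Wᶜ, if q u v ∧ π v < π u then 1 else 0) +
      ∑ v ∈ Wᶜ, (symmDiff (W.filter fun w => q w v) (W.filter fun w => π w < π v)).card := by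
  have h1 : ((backArcs q π).filter fun p => ¬ (p.1 ∈ W ∧ p.2 ∈ W)).card =
      ∑ u, ∑ v, if (q u v ∧ π v < π u) ∧ ¬ (u ∈ W ∧ v ∈ W) then 1 else 0 := by
    rw [← Fintype.sum_prod_type' (f := fun u v =>
      if (q u v ∧ π v < π u) ∧ ¬ (u ∈ W ∧ v ∈ W) then 1 else 0), ← Finset.card_filter]
    congr 1
    ext p
    simp [mem_backArcs]
  have hW : ∀ u ∈ W, (∑ v, if (q u v ∧ π v < π u) ∧ ¬ (u ∈ W ∧ v ∈ W) then 1 else 0) =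
      ∑ v ∈ Wᶜ, if q u v ∧ π v < π u then 1 else 0 := fun u hu => by
    rw [← Finset.sum_add_sum_compl W, Finset.sum_eq_zero, zero_add]
    · exact Finset.sum_congr rfl fun v hv => by simp_all
    · intro v hv
      simp_all
  have hWc : ∀ u ∈ Wᶜ, (∑ v, if (q u v ∧ π v < π u) ∧ ¬ (u ∈ W ∧ v ∈ W) then 1 else 0) =
      (∑ v ∈ W, if q u v ∧ π v < π u then 1 else 0) +
      ∑ v ∈ Wᶜ, if q u v ∧ π v < π u then 1 else 0 := fun u hu => by
    rw [← Finset.sum_add_sum_compl W]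
    congr 1 <;> exact Finset.sum_congr rfl fun v hv => by simp_all
  have hv : ∀ v ∈ Wᶜ,
      (symmDiff (W.filter fun w => q w v) (W.filter fun w => π w < π v)).card =
      (∑ w ∈ W, if q w v ∧ π v < π w then 1 else 0) +
      ∑ w ∈ W, if q v w ∧ π w < π v then 1 else 0 := fun v hv => by
    rw [← Finset.card_filter, ← Finset.card_filter, symmDiff, Finset.sup_eq_union,
      Finset.card_union_of_disjoint disjoint_sdiff_sdiff]
    have hne : ∀ w ∈ W, w ≠ v := fun w hw h => by simp_all
    congr 2 <;> ext w <;> simp only [Finset.mem_sdiff, Finset.mem_filter] <;>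
      by_cases hw : w ∈ W <;> simp only [hw, true_and, false_and]
    · have := hπ.ne (hne w hw)
      have : ¬ π w < π v ↔ π v < π w := by omega
      tauto
    · have := hq.2 w v (hne w hw)
      tauto
  rw [h1, ← Finset.sum_add_sum_compl W, Finset.sum_congr rfl hW, Finset.sum_congr rfl hWc,
    Finset.sum_congr rfl hv, Finset.sum_add_distrib, Finset.sum_add_distrib,
    Finset.sum_comm (s := W)]
  ring

/-- If `W` is transitive and no directed triangle has two vertices in `W`, then sorting `W`
within its own positions does not increase the number of back arcs not inside `W`. -/
theorem exists_sorted_numbering {q : V → V → Prop} (hq : IsTournament q) (W : Finset V)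
    (hW : RelAcyclic fun u v => u ∈ W ∧ v ∈ W ∧ q u v)
    (hnoTri : ∀ a b c, q a b → q b c → q c a → a ∈ W → b ∈ W → False)
    {π : V → ℕ} (hπ : Function.Injective π) :
    ∃ σ : V → ℕ, Function.Injective σ ∧ (∀ u ∈ W, ∀ v ∈ W, q u v → σ u < σ v) ∧
      ((backArcs q σ).filter fun p => ¬ (p.1 ∈ W ∧ p.2 ∈ W)).card ≤
        ((backArcs q π).filter fun p => ¬ (p.1 ∈ W ∧ p.2 ∈ W)).card := by
  classical
  obtain ⟨f, hf⟩ := hW.exists_rank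
  have htot : ∀ u v, u ≠ v → q u v ∨ q v u := fun u v huv => by
    have := hq.2 u v huv
    tauto
  have hfinj : Set.InjOn f W := by
    intro u hu v hv huv
    by_contra hne
    rcases htot u v hne with h | h
    · exact (hf u v ⟨hu, hv, h⟩).ne huv
    · exact (hf v u ⟨hv, hu, h⟩).ne huv.symm
  obtain ⟨σ, hσ, hσc, himg, hmono⟩ := exists_rearrangement W hfinj hπ
  have hσq : ∀ u ∈ W, ∀ v ∈ W, q u v → σ u < σ v :=
    fun u hu v hv h => hmono u hu v hv (hf u v ⟨hu, hv, h⟩)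
  refine ⟨σ, hσ, hσq, ?_⟩
  rw [card_backArcs_not_inside hq W hσ, card_backArcs_not_inside hq W hπ]
  refine add_le_add (le_of_eq ?_) (Finset.sum_le_sum fun v hv => ?_)
  · refine Finset.sum_congr rfl fun u hu => Finset.sum_congr rfl fun v hv => ?_
    rw [hσc u (Finset.mem_compl.1 hu), hσc v (Finset.mem_compl.1 hv)]
  have hvW := Finset.mem_compl.1 hv
  rw [hσc v hvW]
  refine card_symmDiff_le_of_comparable (card_filter_lt_eq_of_image_eq hσ hπ himg _) ?_
  by_contra! hcon
  obtain ⟨a, ha, ha'⟩ := Finset.not_subset.1 hcon.1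
  obtain ⟨b, hb, hb'⟩ := Finset.not_subset.1 hcon.2
  simp only [Finset.mem_filter, not_and] at ha ha' hb hb'
  have hba : σ b < σ a := by
    have := ha' ha.1
    omega
  have hne : b ≠ a := by
    rintro rfl
    exact lt_irrefl _ hba
  have hqba : q b a := (htot b a hne).resolve_right fun h =>
    (hσq a ha.1 b hb.1 h).not_gt hba
  have hqvb : q v b := (htot v b (by rintro rfl; exact hvW hb.1)).resolve_right (hb' hb.1)
  exact hnoTri b a v hqba ha.2 hqvb hb.1 ha.1

end Crossing

theorem tauFASOn_le_card_backArcs_inside {V : Type*} [Fintype V] [DecidableEq V]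
    {r : V → V → Prop} (hr : IsTournament r) (W : Finset V) {π : V → ℕ}
    (hπ : Function.Injective π) :
    tauFASOn r W ≤ ((backArcs r π).filter fun p => p.1 ∈ W ∧ p.2 ∈ W).card := by
  refine Nat.sInf_le ⟨_, fun p hp => ?_, rfl, relAcyclic_of_rank π fun u v huv => ?_⟩
  · rw [Finset.mem_filter, mem_backArcs] at hp
    exact ⟨hp.2.1, hp.2.2, hp.1.1⟩
  · obtain ⟨hu, hv, h⟩ := huv
    refine hr.rank_lt_of_reverseArcs_backArcs hπ ?_
    simpa [reverseArcs, hu, hv] using h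

theorem reverseArcs_iff_of_not_inside {V : Type*} {r : V → V → Prop} {W : Finset V}
    {T : Finset (V × V)} (hT : ∀ p ∈ T, p.1 ∈ W ∧ p.2 ∈ W) {u v : V} (h : ¬ (u ∈ W ∧ v ∈ W)) :
    reverseArcs r (T : Set (V × V)) u v ↔ r u v := by
  have h1 : (u, v) ∉ T := fun hm => h (hT _ hm)
  have h2 : (v, u) ∉ T := fun hm => h (hT _ hm).symm
  simp [reverseArcs, h1, h2]

/-- A feedback arc set of `r` yields one of the reversed tournament that avoids the arcs inside
`W` and is smaller by at least `tauFASOn r W`. -/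
theorem exists_isFAS_reverseArcs {V : Type*} [Fintype V] [DecidableEq V]
    {r : V → V → Prop} (hr : IsTournament r) {W : Finset V} {T : Finset (V × V)}
    (hTW : ∀ p ∈ T, p.1 ∈ W ∧ p.2 ∈ W)
    (hTfas : RelAcyclic (fun u v => u ∈ W ∧ v ∈ W ∧ reverseArcs r ↑T u v))
    (hnoTri : ∀ a b c, reverseArcs r ↑T a b → reverseArcs r ↑T b c → reverseArcs r ↑T c a →
      a ∈ W → b ∈ W → False)
    {S : Finset (V × V)} (hS : IsFAS r ↑S) :
    ∃ S' : Finset (V × V), IsFAS (reverseArcs r ↑T) ↑S' ∧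
      (∀ p ∈ S', ¬ (p.1 ∈ W ∧ p.2 ∈ W)) ∧ S'.card + tauFASOn r W ≤ S.card := by
  obtain ⟨π, hπ⟩ := hS.2.exists_rank
  have hπinj := (hr.reverseArcs ↑S).injective_of_rank hπ
  have hq := hr.reverseArcs (T : Set (V × V))
  obtain ⟨σ, hσ, hmono, hle⟩ := exists_sorted_numbering hq W hTfas hnoTri hπinj
  have hout : ∀ p ∈ backArcs (reverseArcs r ↑T) σ, ¬ (p.1 ∈ W ∧ p.2 ∈ W) := fun p hp hpW => by
    rw [mem_backArcs] at hp
    exact (hmono _ hpW.1 _ hpW.2 hp.1).not_gt hp.2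
  refine ⟨backArcs (reverseArcs r ↑T) σ, hq.isFAS_backArcs hσ, hout, ?_⟩
  rw [Finset.filter_true_of_mem hout] at hle
  have heq : ((backArcs (reverseArcs r ↑T) π).filter fun p => ¬ (p.1 ∈ W ∧ p.2 ∈ W)) =
      (backArcs r π).filter fun p => ¬ (p.1 ∈ W ∧ p.2 ∈ W) := by
    ext p
    simp only [Finset.mem_filter, mem_backArcs]
    refine and_congr_left fun hp => ?_
    rw [reverseArcs_iff_of_not_inside hTW hp]
  rw [heq] at hle
  have h1 := tauFASOn_le_card_backArcs_inside hr W hπinj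
  have h2 := Finset.card_filter_add_card_filter_not (s := backArcs r π)
    (fun p : V × V => p.1 ∈ W ∧ p.2 ∈ W)
  have h3 := Finset.card_le_card (backArcs_subset hπ)
  omega

theorem exists_isFAS_of_isFAS_reverseArcs {V : Type*} [Fintype V] [DecidableEq V]
    {r : V → V → Prop} (hr : IsTournament r) {T S : Finset (V × V)}
    (hS : IsFAS (reverseArcs r ↑T) ↑S) :
    ∃ S' : Finset (V × V), IsFAS r ↑S' ∧ S'.card ≤ S.card + T.card := by
  obtain ⟨π, hπ⟩ := hS.2.exists_rank
  have hπinj := ((hr.reverseArcs ↑T).reverseArcs ↑S).injective_of_rank hπ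
  refine ⟨backArcs r π, hr.isFAS_backArcs hπinj,
    (Finset.card_le_card fun p hp => ?_).trans (Finset.card_union_le S T)⟩
  rw [mem_backArcs] at hp
  rw [Finset.mem_union, or_iff_not_imp_right]
  exact fun hT => backArcs_subset hπ (mem_backArcs.2 ⟨Or.inl ⟨hp.1, hT⟩, hp.2⟩)

theorem isFAS_union {V : Type*} [DecidableEq V] {r : V → V → Prop} {W : Finset V}
    {T S : Finset (V × V)} (hTW : ∀ p ∈ T, p.1 ∈ W ∧ p.2 ∈ W ∧ r p.1 p.2)
    (hSW : ∀ p ∈ S, ¬ (p.1 ∈ W ∧ p.2 ∈ W)) (hS : IsFAS (reverseArcs r ↑T) ↑S) :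
    IsFAS r ↑(S ∪ T) := by
  have hT : ∀ p ∈ T, p.1 ∈ W ∧ p.2 ∈ W := fun p hp => ⟨(hTW p hp).1, (hTW p hp).2.1⟩
  refine ⟨fun p hp => ?_, ?_⟩
  · rcases Finset.mem_union.1 (Finset.mem_coe.1 hp) with h | h
    · exact (reverseArcs_iff_of_not_inside hT (hSW p h)).1 (hS.1 p h)
    · exact (hTW p h).2.2
  · convert hS.2 using 1
    ext u v
    have h1 : (u, v) ∈ S → (u, v) ∉ T ∧ (v, u) ∉ T := fun h =>
      ⟨fun h' => hSW _ h (hT _ h'), fun h' => hSW _ h (hT _ h').symm⟩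
    have h2 : (v, u) ∈ S → (u, v) ∉ T ∧ (v, u) ∉ T := fun h =>
      ⟨fun h' => hSW _ h (hT _ h').symm, fun h' => hSW _ h (hT _ h')⟩
    simp only [reverseArcs, Finset.mem_coe, Finset.mem_union]
    tauto

/-- correctness of Rule 2 for FAST. Let `H` be the subtournament of the
tournament `G = (V,A)` induced by `W` and let `T` be a minimum feedback arc set of `H`
such that after reversing `T` in `G`, no directed triangle contains an arc with both
endpoints in `W`. Then for every `k ≥ τ(H)`, `G` has a feedback arc set of size at most
`k` iff the reversed tournament `G'` has one of size at most `k - τ(H)`; in particular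
there is a minimum-size feedback arc set of `G` containing `T`. -/
theorem stmt5 {V : Type*} [Fintype V] [DecidableEq V]
    (r : V → V → Prop) (hr : IsTournament r)
    (W : Finset V) (T : Finset (V × V))
    (hTW : ∀ p ∈ T, p.1 ∈ W ∧ p.2 ∈ W ∧ r p.1 p.2)
    (hTfas : RelAcyclic (fun u v => u ∈ W ∧ v ∈ W ∧ reverseArcs r ↑T u v))
    (hTmin : T.card = tauFASOn r W)
    (hnoTri : ¬ ∃ a b c : V, reverseArcs r ↑T a b ∧ reverseArcs r ↑T b c ∧
      reverseArcs r ↑T c a ∧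
      ((a ∈ W ∧ b ∈ W) ∨ (b ∈ W ∧ c ∈ W) ∨ (c ∈ W ∧ a ∈ W)))
    (k : ℕ) (hk : tauFASOn r W ≤ k) :
    ((∃ S : Finset (V × V), IsFAS r ↑S ∧ S.card ≤ k) ↔
      (∃ S : Finset (V × V), IsFAS (reverseArcs r ↑T) ↑S ∧ S.card ≤ k - tauFASOn r W)) ∧
    (∃ S : Finset (V × V), IsFAS r ↑S ∧
      (∀ S' : Finset (V × V), IsFAS r ↑S' → S.card ≤ S'.card) ∧ T ⊆ S) := by
  have hT : ∀ p ∈ T, p.1 ∈ W ∧ p.2 ∈ W := fun p hp => ⟨(hTW p hp).1, (hTW p hp).2.1⟩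
  have htri : ∀ a b c, reverseArcs r ↑T a b → reverseArcs r ↑T b c → reverseArcs r ↑T c a →
      a ∈ W → b ∈ W → False := fun a b c h1 h2 h3 ha hb =>
    hnoTri ⟨a, b, c, h1, h2, h3, Or.inl ⟨ha, hb⟩⟩
  refine ⟨⟨?_, ?_⟩, ?_⟩
  · rintro ⟨S, hS, hSk⟩
    obtain ⟨S', hS', -, hcard⟩ := exists_isFAS_reverseArcs hr hT hTfas htri hS
    exact ⟨S', hS', by omega⟩
  · rintro ⟨S, hS, hSk⟩
    obtain ⟨S', hS', hcard⟩ := exists_isFAS_of_isFAS_reverseArcs hr hS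
    exact ⟨S', hS', by omega⟩
  · have hne : {S : Finset (V × V) | IsFAS r ↑S}.Nonempty :=
      ⟨_, hr.isFAS_backArcs (π := fun v => (Fintype.equivFin V v : ℕ))
        (Fin.val_injective.comp (Fintype.equivFin V).injective)⟩
    obtain ⟨S, hS, hmin⟩ := Set.exists_min_image _ Finset.card (Set.toFinite _) hne
    obtain ⟨S', hS', hout, hcard⟩ := exists_isFAS_reverseArcs hr hT hTfas htri hS
    refine ⟨S' ∪ T, isFAS_union hTW hout hS', fun S'' hS'' => ?_, Finset.subset_union_right⟩
    have h1 := hmin S'' hS''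
    have h2 := Finset.card_union_le S' T
    omega
end

section
/- Let G = (V,A) be a tournament, let H = (W,F) be an induced subtournament of G, and let T ⊆ F be a feedback arc set of H such that in the tournament obtained from G by reversing the arcs of T, no directed triangle contains an arc with both endpoints in W. Let w_1, …, w_{|W|} be the linear ordering of W under which the tournament obtained from H by reversing T is acyclic (all its arcs point forward). Then for all i < j: N⁺(w_j) ⊆ N⁺(w_i) and N⁻(w_i) ⊆ N⁻(w_j), where N⁺(w) := {v ∈ V∖W : (w,v) ∈ A} and N⁻(w) := {v ∈ V∖W : (v,w) ∈ A} are the out- and in-neighborhoods of w in V∖W taken in G. -/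
/-- An arc outside `S` survives the reversal of the arcs in `S`. -/
theorem reverseArcs_of_notMem {V : Type*} {r : V → V → Prop} {S : Set (V × V)} {u v : V}
    (h : r u v) (hS : (u, v) ∉ S) : reverseArcs r S u v :=
  Or.inl ⟨h, hS⟩

/-- the neighborhood inclusions (1) in the proof of Lemma 5. Let `H` be
the subtournament of the tournament `G` induced by `W` and `T ⊆ A(H)` a feedback arc set
of `H` such that after reversing `T` in `G` no directed triangle contains an arc with
both endpoints in `W`. Let `w 0, …, w (N-1)` enumerate `W` in the linear order under
which `H` with `T` reversed is acyclic (all arcs pointing forward). Then for `i < j` we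
have `N⁺(w j) ⊆ N⁺(w i)` and `N⁻(w i) ⊆ N⁻(w j)`, the out- and in-neighborhoods being taken
in `G` within `V ∖ W`. -/
theorem stmt6 {V : Type*} [Fintype V] [DecidableEq V]
    (r : V → V → Prop) (hr : IsTournament r)
    (W : Finset V) (T : Finset (V × V))
    (hTW : ∀ p ∈ T, p.1 ∈ W ∧ p.2 ∈ W ∧ r p.1 p.2)
    (hnoTri : ¬ ∃ a b c : V, reverseArcs r ↑T a b ∧ reverseArcs r ↑T b c ∧
      reverseArcs r ↑T c a ∧
      ((a ∈ W ∧ b ∈ W) ∨ (b ∈ W ∧ c ∈ W) ∨ (c ∈ W ∧ a ∈ W)))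
    (N : ℕ) (hN : N = W.card) (w : Fin N → V)
    (hw_mem : ∀ i, w i ∈ W) (hw_inj : Function.Injective w)
    (hw_forward : ∀ i j : Fin N, i < j → reverseArcs r ↑T (w i) (w j)) :
    ∀ i j : Fin N, i < j →
      {v : V | v ∉ W ∧ r (w j) v} ⊆ {v : V | v ∉ W ∧ r (w i) v} ∧
      {v : V | v ∉ W ∧ r v (w i)} ⊆ {v : V | v ∉ W ∧ r v (w j)} := by
  intro i j hij
  have no_path : ∀ v, v ∉ W → r (w j) v → ¬ r v (w i) := fun v hv hjv hvi =>
    hnoTri ⟨w i, w j, v, hw_forward i j hij,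
      reverseArcs_of_notMem hjv fun h => hv (hTW _ h).2.1,
      reverseArcs_of_notMem hvi fun h => hv (hTW _ h).1,
      Or.inl ⟨hw_mem i, hw_mem j⟩⟩
  have ne_w : ∀ v, v ∉ W → ∀ k, v ≠ w k := fun v hv k h => hv (h ▸ hw_mem k)
  refine ⟨fun v ⟨hv, hjv⟩ => ⟨hv, ?_⟩, fun v ⟨hv, hvi⟩ => ⟨hv, ?_⟩⟩
  · exact (hr.2 (w i) v (ne_w v hv i).symm).2 (no_path v hv hjv)
  · exact (hr.2 v (w j) (ne_w v hv j)).2 fun hjv => no_path v hv hjv hvi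
end

section
/- Let G = (V,A) be a tournament and σ a linear ordering of V. Let u and v be vertices such that v precedes u in σ, and let Y be the set of vertices lying strictly between v and u in σ. If N⁺(v) ∩ Y ⊆ N⁺(u) ∩ Y and N⁻(u) ∩ Y ⊆ N⁻(v) ∩ Y (out- and in-neighborhoods taken in G), then the ordering σ′ obtained from σ by exchanging the positions of u and v has at most as many backward arcs with exactly one endpoint in {u,v} as σ has, where a backward arc of an ordering is an arc (x,y) ∈ A such that x comes after y in the ordering. -/
/-- The number of backward arcs of the ordering `σ` of the tournament `r` having exactly
one endpoint in `{u, v}`; a backward arc is an arc `(x, y)` with `x` after `y` in the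
ordering. -/
def backwardArcsAt {V : Type*} [Fintype V] [DecidableEq V]
    (r : V → V → Prop) [DecidableRel r] (σ : V → Fin (Fintype.card V)) (u v : V) : ℕ :=
  (Finset.univ.filter (fun p : V × V => r p.1 p.2 ∧ σ p.2 < σ p.1 ∧
    (((p.1 = u ∨ p.1 = v) ∧ ¬ (p.2 = u ∨ p.2 = v)) ∨
      (¬ (p.1 = u ∨ p.1 = v) ∧ (p.2 = u ∨ p.2 = v))))).card

/-- the swapping argument in the proof of Lemma 5. Let `σ` be a linear
ordering of the vertices of a tournament, `v` before `u`, and `Y` the set of vertices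
strictly between them. If `N⁺(v) ∩ Y ⊆ N⁺(u) ∩ Y` and `N⁻(u) ∩ Y ⊆ N⁻(v) ∩ Y`, then the
ordering obtained by exchanging the positions of `u` and `v` has at most as many backward
arcs with exactly one endpoint in `{u, v}` as `σ` has. -/
theorem stmt7 {V : Type*} [Fintype V] [DecidableEq V]
    (r : V → V → Prop) [DecidableRel r] (hr : IsTournament r)
    (σ : V ≃ Fin (Fintype.card V)) (u v : V) (hlt : σ v < σ u)
    (hY1 : ∀ y : V, σ v < σ y → σ y < σ u → r v y → r u y)
    (hY2 : ∀ y : V, σ v < σ y → σ y < σ u → r y u → r y v) :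
    backwardArcsAt r (fun x => σ (Equiv.swap u v x)) u v ≤
      backwardArcsAt r (fun x => σ x) u v := by
  have hvu : v ≠ u := fun h => by simp [h] at hlt
  let between : V → Prop := fun y => σ v < σ y ∧ σ y < σ u
  have hswap : ∀ y, y ≠ u → y ≠ v → Equiv.swap u v y = y :=
    fun y hu hv => Equiv.swap_apply_of_ne_of_ne hu hv
  have hbetween : ∀ y, between (Equiv.swap u v y) ↔ between y := by
    intro y
    rcases eq_or_ne y u with rfl | hu
    · simp [between]
    rcases eq_or_ne y v with rfl | hv
    · simp [between]
    rw [hswap y hu hv]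
  let f : V × V → V × V := fun p =>
    if between p.1 ∨ between p.2 then (Equiv.swap u v p.1, Equiv.swap u v p.2) else p
  have hf : Function.Involutive f := by
    rintro ⟨a, b⟩
    by_cases h : between a ∨ between b
    · simp [f, h, hbetween]
    · simp [f, h]
  unfold backwardArcsAt
  refine Finset.card_le_card_of_injOn f ?_ hf.injective.injOn
  rintro ⟨a, b⟩ hp
  simp only [Finset.coe_filter, Finset.mem_univ, true_and, Set.mem_ofPred_eq] at hp ⊢
  obtain ⟨hab, hlt', ⟨ha | ha, hb⟩ | ⟨ha, hb | hb⟩⟩ := hp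
  all_goals
    subst_vars
    have hne := fun x y : V => (σ.injective.ne_iff (x := x) (y := y))
    simp only [Equiv.swap_apply_left, Equiv.swap_apply_right, f, between] at hlt' ⊢
    grind
end

section
/- Let G = (V,A) be a tournament, let t ≥ 1, and let 𝓗 be a vertex-disjoint packing of induced subtournaments of G with 1 ≤ τ(H) ≤ t for every H ∈ 𝓗, such that for no H = (W,F) ∈ 𝓗 does there exist a minimum feedback arc set T ⊆ F of H (|T| = τ(H)) whose reversal in G leaves no directed triangle containing an arc with both endpoints in W. If G has a feedback arc set of size at most k, then k ≤ (2t+1)·(k − h(𝓗)), where h(𝓗) := Σ_{H∈𝓗} τ(H). -/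
/-- Reversing only the arcs of `S` inside `W` agrees, on arcs inside `W`, with reversing `S`. -/
lemma reverseArcs_filter_of_mem {V : Type*} [DecidableEq V] {r : V → V → Prop}
    {S : Finset (V × V)} {W : Finset V} {u v : V} (hu : u ∈ W) (hv : v ∈ W)
    (h : reverseArcs r ↑(S.filter fun p => p.1 ∈ W ∧ p.2 ∈ W) u v) :
    reverseArcs r ↑S u v := by
  simpa [reverseArcs, hu, hv] using h

/-- If no arc of `S` crosses the boundary of `W`, then reversing only the arcs of `S` inside `W`
agrees with reversing `S` on all arcs meeting `W`. -/
lemma reverseArcs_filter_of_no_crossing {V : Type*} [DecidableEq V] {r : V → V → Prop}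
    {S : Finset (V × V)} {W : Finset V} (hS : ∀ p ∈ S, p.1 ∈ W ↔ p.2 ∈ W) {u v : V}
    (huv : u ∈ W ∨ v ∈ W)
    (h : reverseArcs r ↑(S.filter fun p => p.1 ∈ W ∧ p.2 ∈ W) u v) :
    reverseArcs r ↑S u v := by
  have h₁ := hS (u, v)
  have h₂ := hS (v, u)
  simp only [reverseArcs, Finset.coe_filter, Set.mem_ofPred_eq, Finset.mem_coe] at h h₁ h₂ ⊢
  tauto

/-- An acyclic relation has no directed triangle. -/
lemma RelAcyclic.no_triangle {V : Type*} {r : V → V → Prop} (h : RelAcyclic r) {a b c : V}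
    (hab : r a b) (hbc : r b c) (hca : r c a) : False :=
  h a (((Relation.TransGen.single hab).tail hbc).tail hca)

/-- The endpoint count of `S` in `W` is at least `2 τ(W) + 1` when no minimum feedback arc set of
`W` destroys all triangles having an arc inside `W`. -/
lemma two_mul_tauFASOn_lt_sum_endpoints {V : Type*} [Fintype V] [DecidableEq V]
    {r : V → V → Prop} {S : Finset (V × V)} {W : Finset V} (hS : IsFAS r ↑S)
    (hno : ¬ ∃ T : Finset (V × V),
      (∀ p ∈ T, p.1 ∈ W ∧ p.2 ∈ W ∧ r p.1 p.2) ∧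
      T.card = tauFASOn r W ∧
      RelAcyclic (fun u v => u ∈ W ∧ v ∈ W ∧ reverseArcs r ↑T u v) ∧
      ¬ ∃ a b c : V, reverseArcs r ↑T a b ∧ reverseArcs r ↑T b c ∧
        reverseArcs r ↑T c a ∧
        ((a ∈ W ∧ b ∈ W) ∨ (b ∈ W ∧ c ∈ W) ∨ (c ∈ W ∧ a ∈ W))) :
    2 * tauFASOn r W + 1 ≤
      ∑ p ∈ S, ((if p.1 ∈ W then 1 else 0) + (if p.2 ∈ W then 1 else 0)) := by
  set T := S.filter fun p => p.1 ∈ W ∧ p.2 ∈ W with hT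
  have hTr : ∀ p ∈ T, p.1 ∈ W ∧ p.2 ∈ W ∧ r p.1 p.2 := fun p hp => by
    obtain ⟨hpS, h₁, h₂⟩ := Finset.mem_filter.1 hp
    exact ⟨h₁, h₂, hS.1 p hpS⟩
  have hTac : RelAcyclic (fun u v => u ∈ W ∧ v ∈ W ∧ reverseArcs r ↑T u v) := fun v hv =>
    hS.2 v (Relation.TransGen.mono
      (fun _ _ h => reverseArcs_filter_of_mem h.1 h.2.1 h.2.2) _ _ hv)
  have hle : tauFASOn r W ≤ T.card := Nat.sInf_le ⟨T, hTr, rfl, hTac⟩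
  have hcard : 2 * T.card = ∑ p ∈ S, if p.1 ∈ W ∧ p.2 ∈ W then 2 else 0 := by
    rw [hT, Finset.card_filter, Finset.mul_sum]
    simp
  have hterm : ∀ p ∈ S, (if p.1 ∈ W ∧ p.2 ∈ W then 2 else 0) ≤
      (if p.1 ∈ W then 1 else 0) + (if p.2 ∈ W then 1 else 0) := fun p _ => by
    split_ifs <;> simp_all
  rcases hle.lt_or_eq with hlt | heq
  · have := Finset.sum_le_sum hterm
    omega
  · by_cases hcross : ∀ p ∈ S, p.1 ∈ W ↔ p.2 ∈ W
    · refine absurd ⟨T, hTr, heq.symm, hTac, ?_⟩ hno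
      rintro ⟨a, b, c, hab, hbc, hca, h⟩
      exact hS.2.no_triangle
        (reverseArcs_filter_of_no_crossing hcross (by tauto) hab)
        (reverseArcs_filter_of_no_crossing hcross (by tauto) hbc)
        (reverseArcs_filter_of_no_crossing hcross (by tauto) hca)
    · push Not at hcross
      obtain ⟨p, hp, hpW⟩ := hcross
      have := Finset.sum_lt_sum hterm ⟨p, hp, by
        rcases hpW with ⟨h₁, h₂⟩ | ⟨h₁, h₂⟩ <;> simp [h₁, h₂]⟩
      omega

/-- A vertex lies in at most one member of a family of pairwise disjoint sets. -/
lemma sum_ite_mem_le_one {V : Type*} [DecidableEq V] {𝓗 : Finset (Finset V)}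
    (hdisj : ∀ W₁ ∈ 𝓗, ∀ W₂ ∈ 𝓗, W₁ ≠ W₂ → Disjoint W₁ W₂) (v : V) :
    ∑ W ∈ 𝓗, (if v ∈ W then 1 else 0) ≤ 1 := by
  rw [← Finset.card_filter, Finset.card_le_one]
  intro A hA B hB
  rw [Finset.mem_filter] at hA hB
  by_contra hne
  exact Finset.disjoint_left.1 (hdisj A hA.1 B hB.1 hne) hA.2 hB.2

/-- Lemma 6 of the paper. Let `𝓗` be a vertex-disjoint packing of
induced subtournaments of a tournament `G` with `1 ≤ τ(H) ≤ t` for each `H ∈ 𝓗` such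
that for no `H ∈ 𝓗` there is a minimum feedback arc set of `H` whose reversal in `G`
leaves no directed triangle containing an arc with both endpoints in `V(H)`. If `G` has
a feedback arc set of size at most `k`, then `k ≤ (2t+1)·(k - h(𝓗))`. -/
theorem stmt8 {V : Type*} [Fintype V] [DecidableEq V]
    (r : V → V → Prop) (hr : IsTournament r) (t k : ℕ) (ht : 1 ≤ t)
    (𝓗 : Finset (Finset V))
    (hdisj : ∀ W₁ ∈ 𝓗, ∀ W₂ ∈ 𝓗, W₁ ≠ W₂ → Disjoint W₁ W₂)
    (htau₁ : ∀ W ∈ 𝓗, 1 ≤ tauFASOn r W) (htau₂ : ∀ W ∈ 𝓗, tauFASOn r W ≤ t)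
    (hno : ∀ W ∈ 𝓗, ¬ ∃ T : Finset (V × V),
      (∀ p ∈ T, p.1 ∈ W ∧ p.2 ∈ W ∧ r p.1 p.2) ∧
      T.card = tauFASOn r W ∧
      RelAcyclic (fun u v => u ∈ W ∧ v ∈ W ∧ reverseArcs r ↑T u v) ∧
      ¬ ∃ a b c : V, reverseArcs r ↑T a b ∧ reverseArcs r ↑T b c ∧
        reverseArcs r ↑T c a ∧
        ((a ∈ W ∧ b ∈ W) ∨ (b ∈ W ∧ c ∈ W) ∨ (c ∈ W ∧ a ∈ W)))
    (hsol : ∃ S : Finset (V × V), IsFAS r ↑S ∧ S.card ≤ k) :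
    (k : ℤ) ≤ (2 * (t : ℤ) + 1) * ((k : ℤ) - ∑ W ∈ 𝓗, (tauFASOn r W : ℤ)) := by
  obtain ⟨S, hS, hSk⟩ := hsol
  have hlow : ∑ W ∈ 𝓗, (2 * tauFASOn r W + 1) ≤ 2 * S.card := by
    calc ∑ W ∈ 𝓗, (2 * tauFASOn r W + 1)
        ≤ ∑ W ∈ 𝓗, ∑ p ∈ S, ((if p.1 ∈ W then 1 else 0) + (if p.2 ∈ W then 1 else 0)) :=
          Finset.sum_le_sum fun W hW => two_mul_tauFASOn_lt_sum_endpoints hS (hno W hW)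
      _ = ∑ p ∈ S, (∑ W ∈ 𝓗, (if p.1 ∈ W then 1 else 0) +
            ∑ W ∈ 𝓗, (if p.2 ∈ W then 1 else 0)) := by
          rw [Finset.sum_comm]
          simp only [Finset.sum_add_distrib]
      _ ≤ ∑ _p ∈ S, 2 := Finset.sum_le_sum fun p _ =>
          add_le_add (sum_ite_mem_le_one hdisj p.1) (sum_ite_mem_le_one hdisj p.2)
      _ = 2 * S.card := by rw [Finset.sum_const, smul_eq_mul, mul_comm]
  have hup : ∑ W ∈ 𝓗, tauFASOn r W ≤ 𝓗.card * t := by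
    simpa using Finset.sum_le_card_nsmul 𝓗 _ t htau₂
  rw [Finset.sum_add_distrib, ← Finset.mul_sum, Finset.sum_const, smul_eq_mul, mul_one] at hlow
  have hmul := Nat.mul_le_mul_left t (hlow.trans (Nat.mul_le_mul_left 2 hSk))
  zify at hup hmul
  linarith
end

section
/- Let G = (V,E) be a graph and H = (W,F) an induced subgraph of G. Suppose S is a cluster editing set for H with |S| = τ(H) such that for all vertices u, v ∈ W: if u and v lie in the same cluster (connected component) of H △ S, then N_G(u) ∖ W = N_G(v) ∖ W, and if u and v lie in different clusters of H △ S, then N_G(u) ∩ N_G(v) ⊆ W. Then G has a minimum-size cluster editing set S′ with S ⊆ S′; consequently, for every k ≥ τ(H), G has a cluster editing set of size at most k if and only if G △ S has a cluster editing set of size at most k − τ(H). -/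
open SimpleGraph

/-- The graph obtained from `G` by applying the edge modification set `S`. -/
def editEdges {V : Type*} (G : SimpleGraph V) (S : Set (Sym2 V)) : SimpleGraph V :=
  SimpleGraph.fromEdgeSet (symmDiff G.edgeSet S)

/-- A cluster graph: a disjoint union of cliques, equivalently a `P₃`-free graph. -/
def IsClusterGraph {V : Type*} (G : SimpleGraph V) : Prop :=
  ∀ u v w : V, G.Adj u v → G.Adj v w → u ≠ w → G.Adj u w

/-- `S` is a cluster editing set for `G`. -/
def IsClusterEditingSet {V : Type*} (G : SimpleGraph V) (S : Finset (Sym2 V)) : Prop :=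
  (∀ e ∈ S, ¬ e.IsDiag) ∧ IsClusterGraph (editEdges G ↑S)

/-- `τ(G)`: the minimum size of a cluster editing set for `G`. -/
noncomputable def clusterEditNum {V : Type*} [Fintype V] [DecidableEq V]
    (G : SimpleGraph V) : ℕ :=
  sInf {n | ∃ S : Finset (Sym2 V), IsClusterEditingSet G S ∧ S.card = n}

/-- `τ` of the subgraph of `G` induced by `W`: the minimum size of a set of vertex pairs
inside `W` whose modification turns the induced subgraph on `W` into a cluster graph. -/
noncomputable def clusterEditNumOn {V : Type*} [Fintype V] [DecidableEq V]
    (G : SimpleGraph V) (W : Finset V) : ℕ :=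
  sInf {n | ∃ S : Finset (Sym2 V), (∀ e ∈ S, ¬ e.IsDiag) ∧
    (∀ e ∈ S, ∀ v ∈ e, v ∈ W) ∧ S.card = n ∧
    IsClusterGraph ((editEdges G ↑S).induce (W : Set V))}

theorem editEdges_adj {V : Type*} (G : SimpleGraph V) (S : Set (Sym2 V)) (u v : V) :
    (editEdges G S).Adj u v ↔ u ≠ v ∧ ¬ (G.Adj u v ↔ s(u, v) ∈ S) := by
  simp only [editEdges, fromEdgeSet_adj, Set.mem_symmDiff, mem_edgeSet]
  tauto

theorem editEdges_editEdges {V : Type*} (G : SimpleGraph V) (S T : Set (Sym2 V)) :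
    editEdges (editEdges G S) T = editEdges G (symmDiff S T) := by
  ext u v
  simp only [editEdges_adj, Set.mem_symmDiff]
  tauto

theorem IsClusterGraph.reachable_iff {V : Type*} {G : SimpleGraph V} (hG : IsClusterGraph G)
    {u v : V} : G.Reachable u v ↔ u = v ∨ G.Adj u v := by
  constructor
  · rintro ⟨p⟩
    induction p with
    | nil => exact Or.inl rfl
    | cons h _ ih =>
      rcases ih with rfl | h'
      · exact Or.inr h
      · exact or_iff_not_imp_left.2 fun hne => hG _ _ _ h h' hne
  · rintro (rfl | h)
    · exact Reachable.refl _
    · exact h.reachable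

theorem IsClusterGraph.adj_iff {V : Type*} {G : SimpleGraph V} (hG : IsClusterGraph G)
    {u v : V} : G.Adj u v ↔
      u ≠ v ∧ G.connectedComponentMk u = G.connectedComponentMk v := by
  rw [ConnectedComponent.eq, hG.reachable_iff]
  have : G.Adj u v → u ≠ v := fun h => h.ne
  tauto

/-- A graph in which two distinct vertices are adjacent exactly when they carry the same label is
a cluster graph. -/
theorem isClusterGraph_of_label {V L : Type*} {G : SimpleGraph V} (c : V → L)
    (h : ∀ u v, G.Adj u v ↔ u ≠ v ∧ c u = c v) : IsClusterGraph G := by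
  intro u v w huv hvw huw
  rw [h] at *
  exact ⟨huw, huv.2.trans hvw.2⟩

open Classical in
/-- The vertex pairs that have to be edited to turn `G` into the cluster graph whose clusters
are the fibers of `c`. -/
noncomputable def labelEdits {V L : Type*} [Fintype V] (G : SimpleGraph V) (c : V → L) :
    Finset (Sym2 V) :=
  Finset.univ.filter fun e => e ∈ symmDiff G.edgeSet ((⊤ : SimpleGraph L).comap c)ᶜ.edgeSet

theorem mem_labelEdits {V L : Type*} [Fintype V] (G : SimpleGraph V) (c : V → L) (u v : V) :
    s(u, v) ∈ labelEdits G c ↔ u ≠ v ∧ ¬ (G.Adj u v ↔ c u = c v) := by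
  have : G.Adj u v → u ≠ v := fun h => h.ne
  simp only [labelEdits, Finset.mem_filter, Finset.mem_univ, true_and, Set.mem_symmDiff,
    mem_edgeSet, compl_adj, comap_adj, top_adj]
  tauto

theorem labelEdits_isClusterEditingSet {V L : Type*} [Fintype V] (G : SimpleGraph V)
    (c : V → L) : IsClusterEditingSet G (labelEdits G c) := by
  constructor
  · intro e
    induction e with
    | _ u v =>
      rw [mem_labelEdits, Sym2.mk_isDiag_iff]
      exact fun h => h.1
  · refine isClusterGraph_of_label c fun u v => ?_
    rw [editEdges_adj, Finset.mem_coe, mem_labelEdits]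
    tauto

theorem IsClusterEditingSet.exists_eq_labelEdits {V : Type*} [Fintype V] {G : SimpleGraph V}
    {S : Finset (Sym2 V)} (hS : IsClusterEditingSet G S) :
    ∃ c : V → (editEdges G ↑S).ConnectedComponent, S = labelEdits G c := by
  refine ⟨(editEdges G ↑S).connectedComponentMk, ?_⟩
  ext e
  induction e with
  | _ u v =>
    have h₁ := hS.2.adj_iff (u := u) (v := v)
    rw [editEdges_adj, Finset.mem_coe] at h₁
    have h₂ : s(u, v) ∈ S → u ≠ v := fun h => by simpa using hS.1 _ h
    rw [mem_labelEdits]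
    tauto

theorem exists_isClusterEditingSet_card_eq {V : Type*} [Fintype V] [DecidableEq V]
    (G : SimpleGraph V) :
    ∃ S : Finset (Sym2 V), IsClusterEditingSet G S ∧ S.card = clusterEditNum G :=
  Nat.sInf_mem (s := {n | ∃ S : Finset (Sym2 V), IsClusterEditingSet G S ∧ S.card = n})
    ⟨_, _, labelEdits_isClusterEditingSet G id, rfl⟩

theorem clusterEditNum_le {V : Type*} [Fintype V] [DecidableEq V] {G : SimpleGraph V}
    {S : Finset (Sym2 V)} (hS : IsClusterEditingSet G S) : clusterEditNum G ≤ S.card :=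
  Nat.sInf_le ⟨S, hS, rfl⟩

theorem clusterEditNumOn_le_card_filter {V : Type*} [Fintype V] [DecidableEq V]
    {G : SimpleGraph V} {S : Finset (Sym2 V)} (hS : IsClusterEditingSet G S) (W : Finset V) :
    clusterEditNumOn G W ≤ (S.filter fun e => ∀ v ∈ e, v ∈ W).card := by
  refine Nat.sInf_le ⟨_, fun e he => hS.1 e (Finset.mem_filter.1 he).1,
    fun e he => (Finset.mem_filter.1 he).2, rfl, ?_⟩
  rintro ⟨u, hu⟩ ⟨v, hv⟩ ⟨w, hw⟩ huv hvw huw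
  have key := hS.2 u v w
  rw [Finset.mem_coe] at hu hv hw
  simp only [comap_adj, Function.Embedding.subtype_apply, editEdges_adj, Finset.mem_coe,
    Finset.mem_filter, Sym2.mem_iff, forall_eq_or_imp, forall_eq, hu, hv, hw, and_true, ne_eq,
    Subtype.mk.injEq] at *
  exact key huv hvw huw

/-- A set of vertex pairs splits into the pairs inside `W`, the pairs avoiding `W`, and the
pairs with exactly one vertex in `W`. -/
theorem card_eq_inside_add_outside_add_cross {V : Type*} [Fintype V] [DecidableEq V]
    (W : Finset V) (S : Finset (Sym2 V)) :
    S.card = (S.filter fun e => ∀ v ∈ e, v ∈ W).card + (S.filter fun e => ∀ v ∈ e, v ∉ W).card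
      + ∑ w ∈ W, (Wᶜ.filter fun x => s(w, x) ∈ S).card := by
  have hcross : ∑ w ∈ W, (Wᶜ.filter fun x => s(w, x) ∈ S).card =
      ((W.sigma fun w => Wᶜ.filter fun x => s(w, x) ∈ S).image fun p => s(p.1, p.2)).card := by
    rw [Finset.card_image_of_injOn, Finset.card_sigma]
    rintro ⟨a, b⟩ hab ⟨a', b'⟩ hab' h
    simp only [Finset.coe_sigma, Set.mem_sigma_iff, Finset.mem_coe, Finset.mem_filter,
      Finset.mem_compl] at hab hab'
    simp only [Sym2.eq_iff] at h
    rcases h with ⟨rfl, rfl⟩ | ⟨rfl, rfl⟩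
    · rfl
    · exact absurd hab.1 hab'.2.1
  rw [hcross, ← Finset.card_union_of_disjoint, ← Finset.card_union_of_disjoint]
  · congr 1
    ext e
    induction e with
    | _ u v =>
      simp only [Finset.mem_union, Finset.mem_filter, Finset.mem_image, Finset.mem_sigma,
        Finset.mem_compl, Sigma.exists, Sym2.mem_iff, forall_eq_or_imp, forall_eq]
      constructor
      · intro h
        by_cases hu : u ∈ W <;> by_cases hv : v ∈ W
        · exact Or.inl (Or.inl ⟨h, hu, hv⟩)
        · exact Or.inr ⟨u, v, ⟨hu, hv, h⟩, rfl⟩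
        · exact Or.inr ⟨v, u, ⟨hv, hu, Sym2.eq_swap ▸ h⟩, Sym2.eq_swap⟩
        · exact Or.inl (Or.inr ⟨h, hu, hv⟩)
      · rintro ((h | h) | ⟨a, b, h, hab⟩)
        · exact h.1
        · exact h.1
        · exact hab ▸ h.2.2
  · rw [Finset.disjoint_left]
    intro e
    induction e with
    | _ u v =>
      simp only [Finset.mem_union, Finset.mem_filter, Finset.mem_image, Finset.mem_sigma,
        Finset.mem_compl, Sigma.exists, Sym2.mem_iff, forall_eq_or_imp, forall_eq]
      rintro h ⟨a, b, hab, he⟩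
      rw [Sym2.eq_iff] at he
      rcases he with ⟨rfl, rfl⟩ | ⟨rfl, rfl⟩ <;> tauto
  · rw [Finset.disjoint_left]
    intro e
    induction e with
    | _ u v =>
      simp only [Finset.mem_filter, Sym2.mem_iff, forall_eq_or_imp, forall_eq]
      tauto

/-- Among the options "stay alone" and "join the fiber of `c` over a label", there is a cheapest
one for a vertex with neighborhood `N`, and ties can be resolved in favor of staying alone. -/
theorem exists_best_label {V L : Type*} [DecidableEq V] [DecidableEq L] [Finite L]
    (X : Finset V) (c : V → L) (N : Finset V) :
    ∃ o : Option L,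
      (∀ o' : Option L, (symmDiff N (X.filter fun x => some (c x) = o)).card ≤
        (symmDiff N (X.filter fun x => some (c x) = o')).card) ∧
      (o ≠ none → (symmDiff N (X.filter fun x => some (c x) = o)).card < N.card) := by
  obtain ⟨o, ho⟩ := Finite.exists_min fun o : Option L =>
    (symmDiff N (X.filter fun x => some (c x) = o)).card
  have hnone : symmDiff N (X.filter fun x => some (c x) = none) = N := by simp
  rcases (hnone ▸ ho none : _ ≤ N.card).lt_or_eq with h | h
  · exact ⟨o, ho, fun _ => h⟩
  · exact ⟨none, fun o' => by rw [hnone, ← h]; exact ho o', fun h => absurd rfl h⟩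

theorem card_symmDiff_add_two_mul {V : Type*} [DecidableEq V] (A B : Finset V) :
    (symmDiff A B).card + 2 * (A ∩ B).card = A.card + B.card := by
  have h : (symmDiff A B).card = (A \ B).card + (B \ A).card :=
    Finset.card_union_of_disjoint disjoint_sdiff_sdiff
  have h₁ := Finset.card_sdiff_add_card_inter A B
  have h₂ := Finset.card_sdiff_add_card_inter B A
  rw [Finset.inter_comm B A] at h₂
  omega

/-- Two disjoint sets cannot both cover more than half of a third set. -/
theorem not_disjoint_of_card_symmDiff_lt {V : Type*} [DecidableEq V] {A B C : Finset V}
    (hA : (symmDiff A C).card < A.card) (hB : (symmDiff B C).card < B.card) :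
    ¬ Disjoint A B := by
  intro h
  have h₁ := card_symmDiff_add_two_mul A C
  have h₂ := card_symmDiff_add_two_mul B C
  have h₃ : (A ∩ C).card + (B ∩ C).card ≤ C.card := by
    rw [← Finset.card_union_of_disjoint
      (h.mono Finset.inter_subset_left Finset.inter_subset_left)]
    exact Finset.card_le_card (Finset.union_subset Finset.inter_subset_right
      Finset.inter_subset_right)
  omega

theorem filter_mem_labelEdits {V L M : Type*} [Fintype V] [DecidableEq V] [DecidableEq L]
    (G : SimpleGraph V) [DecidableRel G.Adj] {W : Finset V}
    (c : V → L) (b : V → M) {w : V} (hw : w ∈ W) {l : Option L}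
    (hl : ∀ x ∉ W, b w = b x ↔ some (c x) = l) :
    (Wᶜ.filter fun x => s(w, x) ∈ labelEdits G b) =
      symmDiff (Wᶜ.filter fun x => G.Adj w x) (Wᶜ.filter fun x => some (c x) = l) := by
  ext x
  simp only [Finset.mem_filter, Finset.mem_compl, Finset.mem_symmDiff, mem_labelEdits]
  by_cases hx : x ∈ W
  · simp [hx]
  · have hne : w ≠ x := fun h => hx (h ▸ hw)
    have := hl x hx
    tauto

/-- A labelling `c` of the vertices can be changed into one that induces the partition `d` on `W`,
keeps the partition outside `W`, and edits at most as many pairs crossing the boundary of `W` at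
each vertex of `W`. -/
theorem exists_relabel {V L K : Type*} [Fintype V] [DecidableEq V] [Finite L]
    (G : SimpleGraph V) (W : Finset V) (c : V → L) (d : V → K)
    (hsame : ∀ u ∈ W, ∀ v ∈ W, d u = d v → ∀ x ∉ W, G.Adj u x ↔ G.Adj v x)
    (hdiff : ∀ u ∈ W, ∀ v ∈ W, d u ≠ d v → ∀ x ∉ W, G.Adj u x → ¬ G.Adj v x) :
    ∃ c' : V → L ⊕ K, (∀ u ∈ W, ∀ v ∈ W, c' u = c' v ↔ d u = d v) ∧
      (∀ u ∉ W, ∀ v ∉ W, c' u = c' v ↔ c u = c v) ∧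
      ∀ w ∈ W, (Wᶜ.filter fun x => s(w, x) ∈ labelEdits G c').card ≤
        (Wᶜ.filter fun x => s(w, x) ∈ labelEdits G c).card := by
  classical
  choose o hmin hlt using exists_best_label Wᶜ c
  let N : V → Finset V := fun w => Wᶜ.filter fun x => G.Adj w x
  let join : V → L ⊕ K := fun w => (o (N w)).elim (Sum.inr (d w)) Sum.inl
  let c' : V → L ⊕ K := fun v => if v ∈ W then join v else Sum.inl (c v)
  have hin : ∀ v ∈ W, c' v = join v := fun v hv => if_pos hv
  have hout : ∀ v ∉ W, c' v = Sum.inl (c v) := fun v hv => if_neg hv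
  have hjoin : ∀ w x, join w = Sum.inl (c x) ↔ some (c x) = o (N w) := by
    intro w x
    change (o (N w)).elim (Sum.inr (d w)) Sum.inl = Sum.inl (c x) ↔ _
    cases o (N w) <;> simp [eq_comm]
  refine ⟨c', fun u hu v hv => ?_, fun u hu v hv => ?_, fun w hw => ?_⟩
  · rw [hin u hu, hin v hv]
    constructor
    · intro h
      by_contra hne
      have hdisj : Disjoint (N u) (N v) := by
        rw [Finset.disjoint_left]
        intro x hxu hxv
        simp only [N, Finset.mem_filter, Finset.mem_compl] at hxu hxv
        exact hdiff u hu v hv hne x hxu.1 hxu.2 hxv.2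
      change (o (N u)).elim (Sum.inr (d u)) Sum.inl =
        (o (N v)).elim (Sum.inr (d v)) Sum.inl at h
      have hu' := hlt (N u)
      have hv' := hlt (N v)
      revert h hu' hv'
      rcases o (N u) with _ | a <;> rcases o (N v) with _ | b
      · simpa using hne
      · simp
      · simp
      · intro h hu' hv'
        obtain rfl : a = b := by simpa using h
        exact not_disjoint_of_card_symmDiff_lt (hu' (by simp)) (hv' (by simp)) hdisj
    · intro h
      have hN : N u = N v := by
        refine Finset.filter_congr fun x hx => hsame u hu v hv h x (by simpa using hx)
      simp only [join, hN, h]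
  · rw [hout u hu, hout v hv, Sum.inl.injEq]
  · rw [filter_mem_labelEdits G c c' hw (l := o (N w))
        fun x hx => by rw [hin w hw, hout x hx, hjoin],
      filter_mem_labelEdits G c c hw (l := some (c w)) fun x _ => by simp [eq_comm]]
    exact hmin _ _

theorem exists_optimal_superset {V K : Type*} [Fintype V] [DecidableEq V]
    (G : SimpleGraph V) (W : Finset V) (S : Finset (Sym2 V))
    (hSW : ∀ e ∈ S, ∀ v ∈ e, v ∈ W) (hScard : S.card = clusterEditNumOn G W) (d : V → K)
    (hd : ∀ u ∈ W, ∀ v ∈ W, s(u, v) ∈ S ↔ u ≠ v ∧ ¬ (G.Adj u v ↔ d u = d v))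
    (hsame : ∀ u ∈ W, ∀ v ∈ W, d u = d v → ∀ x ∉ W, G.Adj u x ↔ G.Adj v x)
    (hdiff : ∀ u ∈ W, ∀ v ∈ W, d u ≠ d v → ∀ x ∉ W, G.Adj u x → ¬ G.Adj v x) :
    ∃ S' : Finset (Sym2 V), IsClusterEditingSet G S' ∧
      S'.card = clusterEditNum G ∧ S ⊆ S' := by
  obtain ⟨S₀, hS₀, hcard₀⟩ := exists_isClusterEditingSet_card_eq G
  obtain ⟨L, hL, c, hS₀c⟩ : ∃ (L : Type _) (_ : Finite L) (c : V → L), S₀ = labelEdits G c :=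
    ⟨_, inferInstance, hS₀.exists_eq_labelEdits⟩
  obtain ⟨c', hWW, hXX, hWX⟩ := exists_relabel G W c d hsame hdiff
  have hS' := labelEdits_isClusterEditingSet G c'
  have hinside : (labelEdits G c').filter (fun e => ∀ v ∈ e, v ∈ W) = S := by
    ext e
    induction e with
    | _ u v =>
      have hW : s(u, v) ∈ S → u ∈ W ∧ v ∈ W := fun h =>
        ⟨hSW _ h u (Sym2.mem_mk_left _ _), hSW _ h v (Sym2.mem_mk_right _ _)⟩
      simp only [Finset.mem_filter, mem_labelEdits, Sym2.mem_iff, forall_eq_or_imp, forall_eq]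
      constructor
      · rintro ⟨h, hu, hv⟩
        rwa [hd u hu v hv, ← hWW u hu v hv]
      · intro h
        obtain ⟨hu, hv⟩ := hW h
        rw [hWW u hu v hv, ← hd u hu v hv]
        exact ⟨h, hu, hv⟩
  have houtside : (labelEdits G c').filter (fun e => ∀ v ∈ e, v ∉ W) =
      S₀.filter (fun e => ∀ v ∈ e, v ∉ W) := by
    rw [hS₀c]
    ext e
    induction e with
    | _ u v =>
      simp only [Finset.mem_filter, mem_labelEdits, Sym2.mem_iff, forall_eq_or_imp, forall_eq]
      refine and_congr_left fun h => ?_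
      rw [hXX u h.1 v h.2]
  refine ⟨labelEdits G c', hS', le_antisymm ?_ (clusterEditNum_le hS'),
    hinside ▸ Finset.filter_subset _ _⟩
  rw [← hcard₀, card_eq_inside_add_outside_add_cross W (labelEdits G c'),
    card_eq_inside_add_outside_add_cross W S₀, hinside, houtside, hScard]
  have hcross := Finset.sum_le_sum hWX
  rw [← hS₀c] at hcross
  have := clusterEditNumOn_le_card_filter hS₀ W
  omega

/-- correctness of Rule 3 for Cluster Editing. Let `H` be the subgraph
of `G` induced by `W` and let `S` be an optimal cluster editing set for `H` such that
vertices in the same cluster of `H △ S` have the same neighborhoods outside `W` and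
vertices in different clusters have no common neighbor outside `W`. Then `G` has a
minimum-size cluster editing set containing `S`; consequently, for every `k ≥ τ(H)`,
`G` has a cluster editing set of size at most `k` iff `G △ S` has one of size at most
`k - τ(H)`. -/
theorem stmt9 {V : Type*} [Fintype V] [DecidableEq V]
    (G : SimpleGraph V) (W : Finset V) (S : Finset (Sym2 V))
    (hSdiag : ∀ e ∈ S, ¬ e.IsDiag) (hSW : ∀ e ∈ S, ∀ v ∈ e, v ∈ W)
    (hScluster : IsClusterGraph ((editEdges G ↑S).induce (W : Set V)))
    (hScard : S.card = clusterEditNumOn G W)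
    (hsame : ∀ (u : V) (hu : u ∈ (W : Set V)) (v : V) (hv : v ∈ (W : Set V)),
      ((editEdges G ↑S).induce (W : Set V)).Reachable ⟨u, hu⟩ ⟨v, hv⟩ →
        G.neighborSet u \ ↑W = G.neighborSet v \ ↑W)
    (hdiff : ∀ (u : V) (hu : u ∈ (W : Set V)) (v : V) (hv : v ∈ (W : Set V)),
      ¬ ((editEdges G ↑S).induce (W : Set V)).Reachable ⟨u, hu⟩ ⟨v, hv⟩ →
        G.neighborSet u ∩ G.neighborSet v ⊆ ↑W) :
    (∃ S' : Finset (Sym2 V), IsClusterEditingSet G S' ∧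
      S'.card = clusterEditNum G ∧ S ⊆ S') ∧
    (∀ k : ℕ, clusterEditNumOn G W ≤ k →
      ((∃ S₁ : Finset (Sym2 V), IsClusterEditingSet G S₁ ∧ S₁.card ≤ k) ↔
        (∃ S₂ : Finset (Sym2 V), IsClusterEditingSet (editEdges G ↑S) S₂ ∧
          S₂.card ≤ k - clusterEditNumOn G W))) := by
  classical
  have hmain : ∃ S' : Finset (Sym2 V), IsClusterEditingSet G S' ∧
      S'.card = clusterEditNum G ∧ S ⊆ S' := by
    let d : V → Option ((editEdges G ↑S).induce (W : Set V)).ConnectedComponent := fun v =>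
      if h : v ∈ (W : Set V) then
        some (((editEdges G ↑S).induce (W : Set V)).connectedComponentMk ⟨v, h⟩)
      else none
    have hreach : ∀ u (hu : u ∈ (W : Set V)) v (hv : v ∈ (W : Set V)), d u = d v ↔
        ((editEdges G ↑S).induce (W : Set V)).Reachable ⟨u, hu⟩ ⟨v, hv⟩ := by
      intro u hu v hv
      simp only [d, dif_pos hu, dif_pos hv, Option.some.injEq, ConnectedComponent.eq]
    refine exists_optimal_superset G W S hSW hScard d (fun u hu v hv => ?_)
      (fun u hu v hv h x hx => ?_) (fun u hu v hv h x hx hux hvx => ?_)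
    · have h₁ := hScluster.reachable_iff (u := ⟨u, hu⟩) (v := ⟨v, hv⟩)
      rw [← hreach, comap_adj, Subtype.mk.injEq] at h₁
      simp only [Function.Embedding.subtype_apply, editEdges_adj, Finset.mem_coe] at h₁
      have h₂ : s(u, v) ∈ S → u ≠ v := fun h => by simpa using hSdiag _ h
      tauto
    · have := Set.ext_iff.1 (hsame u hu v hv ((hreach u hu v hv).1 h)) x
      simpa [hx] using this
    · exact hx (hdiff u hu v hv (fun h' => h ((hreach u hu v hv).2 h')) ⟨hux, hvx⟩)
  refine ⟨hmain, fun k hk => ⟨?_, ?_⟩⟩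
  · rintro ⟨S₁, hS₁, hS₁k⟩
    obtain ⟨S', hS', hcard, hsub⟩ := hmain
    refine ⟨S' \ S, ⟨fun e he => hS'.1 e (Finset.mem_sdiff.1 he).1, ?_⟩, ?_⟩
    · have : symmDiff (S : Set (Sym2 V)) ↑(S' \ S) = ↑S' := by
        rw [← Finset.coe_symmDiff, symmDiff_sdiff_eq_sup, sup_eq_right.2 hsub]
      rw [editEdges_editEdges, this]
      exact hS'.2
    · rw [Finset.card_sdiff_of_subset hsub, hcard, hScard]
      exact Nat.sub_le_sub_right ((clusterEditNum_le hS₁).trans hS₁k) _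
  · rintro ⟨S₂, hS₂, hS₂k⟩
    refine ⟨symmDiff S S₂, ⟨fun e he => ?_, ?_⟩, ?_⟩
    · rcases Finset.mem_symmDiff.1 he with h | h
      · exact hSdiag e h.1
      · exact hS₂.1 e h.1
    · rw [Finset.coe_symmDiff, ← editEdges_editEdges]
      exact hS₂.2
    · have := card_symmDiff_add_two_mul S S₂
      omega
end

section
/- Let G = (V,E) be a graph in which every vertex has degree at most two and no connected component is a triangle (a cycle on three vertices). Then the minimum size of a cluster editing set of G equals |E| − ν(G), where ν(G) is the maximum size of a matching in G; in particular, deleting all edges of G not contained in a fixed maximum matching yields a minimum-size cluster editing set. -/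
open SimpleGraph

/-- `M` is a matching in `G`: a set of edges of `G` that are pairwise vertex-disjoint. -/
def IsMatchingIn {V : Type*} (G : SimpleGraph V) (M : Finset (Sym2 V)) : Prop :=
  ↑M ⊆ G.edgeSet ∧ ∀ e₁ ∈ M, ∀ e₂ ∈ M, e₁ ≠ e₂ → ∀ v : V, v ∈ e₁ → v ∉ e₂

/-- `ν(G)`: the maximum size of a matching in `G`. -/
noncomputable def matchNum {V : Type*} [Fintype V] (G : SimpleGraph V) : ℕ :=
  sSup {n | ∃ M : Finset (Sym2 V), IsMatchingIn G M ∧ M.card = n}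

/-- If `F` has maximum degree at most two and `N` contains the pair of endpoints of every path on
three vertices in `F`, then at most `N.card` edges suffice to hit all these paths. -/
theorem exists_finset_hitting_paths {V : Type*} [DecidableEq V] (N : Finset (Sym2 V)) :
    ∀ F : SimpleGraph V,
      (∀ v a b c, F.Adj v a → F.Adj v b → F.Adj v c → a = b ∨ a = c ∨ b = c) →
      (∀ u v w, F.Adj u v → F.Adj v w → u ≠ w → s(u, w) ∈ N) →
      ∃ D : Finset (Sym2 V), D.card ≤ N.card ∧
        ∀ u v w, F.Adj u v → F.Adj v w → u ≠ w → s(u, v) ∈ D ∨ s(v, w) ∈ D := by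
  induction N using Finset.strongInduction with
  | H N ih =>
  intro F hdeg hN
  have step : ∀ N' R : Finset (Sym2 V), N' ⊂ N → N'.card + R.card ≤ N.card →
      (∀ u v w, F.Adj u v → F.Adj v w → u ≠ w → s(u, v) ∉ R → s(v, w) ∉ R → s(u, w) ∈ N') →
      ∃ D : Finset (Sym2 V), D.card ≤ N.card ∧
        ∀ u v w, F.Adj u v → F.Adj v w → u ≠ w → s(u, v) ∈ D ∨ s(v, w) ∈ D := by
    intro N' R hss hcard hpath
    obtain ⟨D, hD, hcov⟩ := ih N' hss (F.deleteEdges R)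
      (fun v a b c ha hb hc => hdeg v a b c (deleteEdges_adj.1 ha).1 (deleteEdges_adj.1 hb).1
        (deleteEdges_adj.1 hc).1)
      (fun u v w huv hvw hne => hpath u v w (deleteEdges_adj.1 huv).1 (deleteEdges_adj.1 hvw).1
        hne (deleteEdges_adj.1 huv).2 (deleteEdges_adj.1 hvw).2)
    refine ⟨D ∪ R, (Finset.card_union_le _ _).trans (by omega), fun u v w huv hvw hne => ?_⟩
    simp only [Finset.mem_union]
    by_cases h₁ : s(u, v) ∈ R
    · tauto
    by_cases h₂ : s(v, w) ∈ R
    · tauto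
    have := hcov u v w (deleteEdges_adj.2 ⟨huv, h₁⟩) (deleteEdges_adj.2 ⟨hvw, h₂⟩) hne
    tauto
  by_cases hex : ∃ u v w, F.Adj u v ∧ F.Adj v w ∧ u ≠ w
  swap
  · exact ⟨∅, by simp, fun u v w huv hvw hne => (hex ⟨u, v, w, huv, hvw, hne⟩).elim⟩
  obtain ⟨u, v, w, huv, hvw, huw⟩ := hex
  have hmem := hN u v w huv hvw huw
  by_cases hx : ∃ x, x ≠ v ∧ F.Adj u x ∧ F.Adj x w
  · obtain ⟨x, hxv, hux, hxw⟩ := hx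
    have hmem' := hN v u x huv.symm hux hxv.symm
    have hne : s(v, x) ≠ s(u, w) := by
      have := huv.ne
      have := hvw.ne
      simp only [ne_eq, Sym2.eq_iff]
      tauto
    have hmem'' : s(v, x) ∈ N.erase s(u, w) := Finset.mem_erase.2 ⟨hne, hmem'⟩
    refine step ((N.erase s(u, w)).erase s(v, x)) {s(u, v), s(x, w)}
      ((Finset.erase_ssubset hmem'').trans (Finset.erase_ssubset hmem)) ?_ ?_
    · have h₁ := Finset.card_erase_add_one hmem
      have h₂ := Finset.card_erase_add_one hmem''
      have h₃ : ({s(u, v), s(x, w)} : Finset (Sym2 V)).card ≤ 2 := Finset.card_le_two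
      omega
    · intro a b c hab hbc hac h₁ h₂
      have hu : ∀ y, F.Adj u y → y = v ∨ y = x := fun y hy => by
        have := hdeg u v x y huv hux hy
        grind
      have hv : ∀ y, F.Adj v y → y = u ∨ y = w := fun y hy => by
        have := hdeg v u w y huv.symm hvw hy
        grind
      have hab' := hab.symm
      have hbc' := hbc.symm
      have := hN a b c hab hbc hac
      simp only [Finset.mem_erase, Finset.mem_insert, Finset.mem_singleton, Sym2.eq_iff, ne_eq]
        at *
      grind
  · push Not at hx
    refine step (N.erase s(u, w)) {s(u, v)} (Finset.erase_ssubset hmem) ?_ ?_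
    · simp [Finset.card_erase_add_one hmem]
    · intro a b c hab hbc hac h₁ h₂
      refine Finset.mem_erase.2 ⟨fun h => ?_, hN a b c hab hbc hac⟩
      have hab' := hab.symm
      have hbc' := hbc.symm
      simp only [Finset.mem_singleton, Sym2.eq_iff] at h h₁ h₂
      grind

theorem eq_or_eq_or_eq_of_degree_le_two {V : Type*} [Fintype V] [DecidableEq V]
    {G : SimpleGraph V} [DecidableRel G.Adj] {v : V} (hdeg : G.degree v ≤ 2) {a b c : V}
    (ha : G.Adj v a) (hb : G.Adj v b) (hc : G.Adj v c) : a = b ∨ a = c ∨ b = c := by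
  by_contra! h
  have hcard : ({a, b, c} : Finset V).card = 3 := Finset.card_eq_three.2
    ⟨a, b, c, h.1, h.2.1, h.2.2, rfl⟩
  have hsub : ({a, b, c} : Finset V) ⊆ G.neighborFinset v := by
    intro x hx
    simp only [Finset.mem_insert, Finset.mem_singleton] at hx
    rcases hx with rfl | rfl | rfl <;> simpa
  have := Finset.card_le_card hsub
  rw [card_neighborFinset_eq_degree] at this
  omega

/-- In a graph of maximum degree at most two, the vertices of a triangle form a component. -/
theorem reachable_set_eq_of_triangle {V : Type*} {G : SimpleGraph V}
    (hdeg : ∀ v a b c, G.Adj v a → G.Adj v b → G.Adj v c → a = b ∨ a = c ∨ b = c) {a b c : V}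
    (hab : G.Adj a b) (hbc : G.Adj b c) (hac : G.Adj a c) :
    {x : V | G.Reachable a x} = {a, b, c} := by
  have closed : ∀ x y, G.Walk x y → x ∈ ({a, b, c} : Set V) → y ∈ ({a, b, c} : Set V) := by
    intro x y p
    induction p with
    | nil => exact id
    | @cons x z y hxz _ ih =>
      refine fun hx => ih ?_
      have h₁ := hab.ne
      have h₂ := hbc.ne
      have h₃ := hac.ne
      simp only [Set.mem_insert_iff, Set.mem_singleton_iff] at hx ⊢
      rcases hx with rfl | rfl | rfl
      · have := hdeg _ _ _ _ hab hac hxz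
        grind
      · have := hdeg _ _ _ _ hab.symm hbc hxz
        grind
      · have := hdeg _ _ _ _ hac.symm hbc.symm hxz
        grind
  ext x
  constructor
  · rintro ⟨p⟩
    exact closed a x p (by simp)
  · rintro (rfl | rfl | rfl)
    · exact Reachable.refl _
    · exact hab.reachable
    · exact hac.reachable

theorem IsMatchingIn.card_le_matchNum {V : Type*} [Fintype V] {G : SimpleGraph V}
    {M : Finset (Sym2 V)} (hM : IsMatchingIn G M) : M.card ≤ matchNum G := by
  classical
  refine le_csSup ⟨Fintype.card (Sym2 V), ?_⟩ ⟨M, hM, rfl⟩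
  rintro n ⟨M', _, rfl⟩
  exact Finset.card_le_univ M'

theorem exists_isMatchingIn_card_eq_matchNum {V : Type*} [Fintype V] (G : SimpleGraph V) :
    ∃ M : Finset (Sym2 V), IsMatchingIn G M ∧ M.card = matchNum G := by
  classical
  refine Nat.sSup_mem (s := {n | ∃ M : Finset (Sym2 V), IsMatchingIn G M ∧ M.card = n})
    ⟨0, ∅, by simp [IsMatchingIn], rfl⟩ ⟨Fintype.card (Sym2 V), ?_⟩
  rintro n ⟨M', _, rfl⟩
  exact Finset.card_le_univ M'

/-- Deleting all edges outside a matching leaves a cluster graph. -/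
theorem IsMatchingIn.isClusterEditingSet_sdiff {V : Type*} [Fintype V] [DecidableEq V]
    {G : SimpleGraph V} [DecidableRel G.Adj] {M : Finset (Sym2 V)} (hM : IsMatchingIn G M) :
    IsClusterEditingSet G (G.edgeFinset \ M) := by
  have hadj : ∀ u v, (editEdges G ↑(G.edgeFinset \ M)).Adj u v → s(u, v) ∈ M := by
    intro u v h
    simp only [editEdges, fromEdgeSet_adj, Set.mem_symmDiff, Finset.coe_sdiff, coe_edgeFinset,
      Set.mem_sdiff, Finset.mem_coe] at h
    tauto
  refine ⟨fun e he => G.not_isDiag_of_mem_edgeFinset (Finset.mem_sdiff.1 he).1, ?_⟩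
  intro u v w huv hvw huw
  refine absurd (Sym2.mem_iff.2 (Or.inl rfl)) (hM.2 _ (hadj u v huv) _ (hadj v w hvw) ?_ v
    (Sym2.mem_iff.2 (Or.inr rfl)))
  simp only [ne_eq, Sym2.eq_iff]
  rintro (⟨rfl, rfl⟩ | ⟨rfl, -⟩)
  · exact huw rfl
  · exact huw rfl

/-- Every cluster editing set of a graph of maximum degree at most two without triangles has at
least `|E| - ν(G)` elements. -/
theorem IsClusterEditingSet.card_edgeFinset_le {V : Type*} [Fintype V] [DecidableEq V]
    {G : SimpleGraph V} [DecidableRel G.Adj]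
    (hdeg : ∀ v a b c, G.Adj v a → G.Adj v b → G.Adj v c → a = b ∨ a = c ∨ b = c)
    (htri : ∀ a b c, G.Adj a b → G.Adj b c → ¬ G.Adj a c)
    {S : Finset (Sym2 V)} (hS : IsClusterEditingSet G S) :
    G.edgeFinset.card ≤ S.card + matchNum G := by
  obtain ⟨D, hD, hcov⟩ := exists_finset_hitting_paths (S \ G.edgeFinset) (G.deleteEdges S)
    (fun v a b c ha hb hc => hdeg v a b c (deleteEdges_adj.1 ha).1 (deleteEdges_adj.1 hb).1
        (deleteEdges_adj.1 hc).1) (by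
      intro u v w huv hvw huw
      rw [deleteEdges_adj] at huv hvw
      have hedit : ∀ x y, G.Adj x y ∧ s(x, y) ∉ (S : Set (Sym2 V)) → (editEdges G ↑S).Adj x y :=
        fun x y h => (fromEdgeSet_adj _).2 ⟨Or.inl h, h.1.ne⟩
      have h := hS.2 u v w (hedit u v huv) (hedit v w hvw) huw
      simp only [editEdges, fromEdgeSet_adj, Set.mem_symmDiff, mem_edgeSet, Finset.mem_coe] at h
      have := htri u v w huv.1 hvw.1
      simp only [Finset.mem_sdiff, mem_edgeFinset, mem_edgeSet]
      tauto)
  have hM : IsMatchingIn G ((G.edgeFinset \ S) \ D) := by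
    refine ⟨fun e he => ?_, ?_⟩
    · simp only [Finset.coe_sdiff, coe_edgeFinset, Set.mem_sdiff] at he
      exact he.1.1
    · intro e₁ h₁ e₂ h₂ hne v hv₁ hv₂
      obtain ⟨u, rfl⟩ := hv₁
      obtain ⟨w, rfl⟩ := hv₂
      simp only [Finset.mem_sdiff, mem_edgeFinset, mem_edgeSet] at h₁ h₂
      have := hcov u v w (deleteEdges_adj.2 ⟨h₁.1.1.symm, by rw [Sym2.eq_swap]; exact h₁.1.2⟩)
        (deleteEdges_adj.2 ⟨h₂.1.1, h₂.1.2⟩) (fun h => hne (by rw [h]))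
      rw [Sym2.eq_swap (a := u)] at this
      tauto
  have h₁ := hM.card_le_matchNum
  have h₂ := Finset.le_card_sdiff D (G.edgeFinset \ S)
  have h₃ := Finset.card_sdiff_add_card_inter G.edgeFinset S
  have h₄ := Finset.card_sdiff_add_card_inter S G.edgeFinset
  rw [Finset.inter_comm] at h₄
  omega

/-- the final case in the proof of Theorem 5. If every vertex of `G`
has degree at most two and no connected component of `G` is a triangle, then
`τ(G) = |E| - ν(G)`; in particular, deleting all edges of `G` not contained in a fixed
maximum matching yields a minimum-size cluster editing set. -/
theorem stmt14 {V : Type*} [Fintype V] [DecidableEq V]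
    (G : SimpleGraph V) [DecidableRel G.Adj]
    (hdeg : ∀ v : V, G.degree v ≤ 2)
    (hnotri : ¬ ∃ a b c : V, G.Adj a b ∧ G.Adj b c ∧ G.Adj a c ∧
      {x : V | G.Reachable a x} = {a, b, c}) :
    clusterEditNum G = G.edgeFinset.card - matchNum G ∧
    ∀ M : Finset (Sym2 V), IsMatchingIn G M → M.card = matchNum G →
      IsClusterEditingSet G (G.edgeFinset \ M) ∧
      (G.edgeFinset \ M).card = clusterEditNum G := by
  have hdeg' : ∀ v a b c, G.Adj v a → G.Adj v b → G.Adj v c → a = b ∨ a = c ∨ b = c :=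
    fun v _ _ _ ha hb hc => eq_or_eq_or_eq_of_degree_le_two (hdeg v) ha hb hc
  have htri : ∀ a b c, G.Adj a b → G.Adj b c → ¬ G.Adj a c := fun a b c hab hbc hac =>
    hnotri ⟨a, b, c, hab, hbc, hac, reachable_set_eq_of_triangle hdeg' hab hbc hac⟩
  have hcard : ∀ M : Finset (Sym2 V), IsMatchingIn G M → M.card = matchNum G →
      (G.edgeFinset \ M).card = G.edgeFinset.card - matchNum G := by
    intro M hM hMc
    rw [Finset.card_sdiff_of_subset (fun e he => mem_edgeFinset.2 (hM.1 he)), hMc]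
  obtain ⟨M₀, hM₀, hM₀c⟩ := exists_isMatchingIn_card_eq_matchNum G
  have hmain : clusterEditNum G = G.edgeFinset.card - matchNum G := by
    refine IsLeast.csInf_eq ⟨⟨_, hM₀.isClusterEditingSet_sdiff, hcard M₀ hM₀ hM₀c⟩, ?_⟩
    rintro n ⟨S, hS, rfl⟩
    have := hS.card_edgeFinset_le hdeg' htri
    omega
  exact ⟨hmain, fun M hM hMc =>
    ⟨hM.isClusterEditingSet_sdiff, (hcard M hM hMc).trans hmain.symm⟩⟩
end
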